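/- Suppose Assumptions (A1.a), (A1.b), (A2.b), (A3.a) and (A3.c) hold, and that there exist a positive integer h and a constant θ > 0 such that inf_{m≥0} (λ_m^h − Δ_m^h) ≥ θ almost surely. Then the distributed estimation algorithm with random time-varying communication delays converges in mean square: for every node i = 1,…,N, lim_{k→∞} E‖x_i(k) − x_0‖² = 0. -/

import Mathlib

open MeasureTheory Filter Matrix Topology
open scoped Kronecker

/-- Spectral (2-)norm of a real matrix. -/
noncomputable def specNorm {p q : Type*} [Fintype p] [Fintype q] [DecidableEq q]
    (A : Matrix p q ℝ) : ℝ :=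
  ‖LinearMap.toContinuousLinearMap (Matrix.toEuclideanLin A)‖

/-- Smallest eigenvalue of a (symmetric) real matrix, as the infimum of the Rayleigh
quotient over the unit sphere. -/
noncomputable def lambdaMin {p : Type*} [Fintype p] (A : Matrix p p ℝ) : ℝ :=
  ⨅ x : {x : p → ℝ // ∑ i, x i ^ 2 = 1}, dotProduct x.1 (A.mulVec x.1)

/-- Entrywise conditional expectation of a random matrix. -/
noncomputable def cexpM {Ω : Type*} [MeasurableSpace Ω] (μ : Measure Ω)
    (m : MeasurableSpace Ω) {p q : Type*} (M : Ω → Matrix p q ℝ) (ω : Ω) :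
    Matrix p q ℝ :=
  Matrix.of fun i j => (μ[(fun ω' => M ω' i j)|m]) ω

/-- Degree matrix of a weighted adjacency matrix. -/
def degMat {N : ℕ} (A : Matrix (Fin N) (Fin N) ℝ) : Matrix (Fin N) (Fin N) ℝ :=
  Matrix.diagonal (fun i => ∑ j, A i j)

/-- Laplacian matrix of a weighted adjacency matrix. -/
def lapl {N : ℕ} (A : Matrix (Fin N) (Fin N) ℝ) : Matrix (Fin N) (Fin N) ℝ :=
  degMat A - A

/-- Symmetrized Laplacian `(ℒ + ℒᵀ)/2`. -/
noncomputable def symmLapl {N : ℕ} (A : Matrix (Fin N) (Fin N) ℝ) :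
    Matrix (Fin N) (Fin N) ℝ :=
  (2:ℝ)⁻¹ • (lapl A + (lapl A)ᵀ)

/-- The `Nn × Nn` matrix `ℋᵀℋ`, where `ℋ = blockdiag(H_1, …, H_N)`. -/
def blockHtH {N n : ℕ} {ni : Fin N → ℕ}
    (H : ∀ i : Fin N, Matrix (Fin (ni i)) (Fin n) ℝ) :
    Matrix (Fin N × Fin n) (Fin N × Fin n) ℝ :=
  Matrix.of fun p q => if p.1 = q.1 then ((H p.1)ᵀ * H p.1) p.2 q.2 else 0

/-- Delay matrix `𝕀(k,q)`: entry `(i,j)` is `1` if `λ_{ji}(k) = q` and `0` otherwise. -/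
def delayMat {N : ℕ} (lam : Fin N → Fin N → ℕ) (q : ℕ) : Matrix (Fin N) (Fin N) ℝ :=
  Matrix.of fun i j => if lam j i = q then 1 else 0

/-- The delay-weighted adjacency matrix `Ā(k,q) = (𝒜(k) ∘ 𝕀(k,q)) ⊗ I_n`. -/
def delayAdj {N : ℕ} (n : ℕ) (A : Matrix (Fin N) (Fin N) ℝ)
    (lam : Fin N → Fin N → ℕ) (q : ℕ) :
    Matrix (Fin N × Fin n) (Fin N × Fin n) ℝ :=
  (Matrix.hadamard A (delayMat lam q)) ⊗ₖ (1 : Matrix (Fin n) (Fin n) ℝ)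

/-- The backward matrix product `Φ_F(j,i) = F(j)F(j−1)⋯F(i)` for `j ≥ i`, and `I` for
`j < i`, for a family of square matrices indexed by `ℤ`. -/
noncomputable def phiProdZ {p : Type*} [Fintype p] [DecidableEq p]
    (F : ℤ → Matrix p p ℝ) (j i : ℤ) : Matrix p p ℝ :=
  if i ≤ j then ((List.range ((j - i).toNat + 1)).map (fun t => F (j - (t:ℤ)))).prod else 1

/-- The σ-field `ℱ(k-1) = σ(𝒜(s), v(s), H_i(s), λ_{ji}(s) : 1 ≤ i,j ≤ N, 0 ≤ s ≤ k-1)`,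
generated by the randomness strictly before time `k` (trivial for `k = 0`). -/
def sigBeforeD {Ω : Type*} {N n : ℕ} {ni : Fin N → ℕ}
    (H : ℕ → ∀ i : Fin N, Ω → Matrix (Fin (ni i)) (Fin n) ℝ)
    (v : ℕ → Ω → ∀ i : Fin N, Fin (ni i) → ℝ)
    (A : ℕ → Ω → Matrix (Fin N) (Fin N) ℝ)
    (lam : ℕ → Fin N → Fin N → Ω → ℕ) (k : ℕ) : MeasurableSpace Ω :=
  ⨆ s, ⨆ _ : s < k,
    MeasurableSpace.comap
        (fun ω (i : Fin N) (p : Fin (ni i)) (c : Fin n) => H s i ω p c) inferInstance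
    ⊔ MeasurableSpace.comap (v s) inferInstance
    ⊔ MeasurableSpace.comap (fun ω (i j : Fin N) => A s ω i j) inferInstance
    ⊔ MeasurableSpace.comap (fun ω (j i : Fin N) => lam s j i ω) inferInstance

/-- A nonnegative sequence driven by a contraction with non-summable rate and a forcing
negligible with respect to that rate tends to zero. -/
theorem tendsto_zero_of_contraction {Z α ε : ℕ → ℝ} (hZ : ∀ m, 0 ≤ Z m)
    (hα : ∀ᶠ m in atTop, α m ≤ 1) (hα0 : ∀ m, 0 ≤ α m)
    (hsum : Tendsto (fun M => ∑ m ∈ Finset.range M, α m) atTop atTop)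
    (hε : Tendsto ε atTop (𝓝 0))
    (hrec : ∀ᶠ m in atTop, Z (m + 1) ≤ (1 - α m) * Z m + ε m * α m) :
    Tendsto Z atTop (𝓝 0) := by
  rw [Metric.tendsto_atTop]
  intro η hη
  have hε' : ∀ᶠ m in atTop, ε m < η / 2 := hε.eventually (gt_mem_nhds (by linarith))
  obtain ⟨M, hM⟩ := eventually_atTop.1 (hα.and (hrec.and hε'))
  have key : ∀ j, Z (M + j) - η / 2 ≤
      Real.exp (-(∑ m ∈ Finset.range (M + j), α m - ∑ m ∈ Finset.range M, α m)) * Z M := by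
    intro j
    induction j with
    | zero => simp; linarith
    | succ j ih =>
      obtain ⟨h1, h2, h3⟩ := hM (M + j) (by omega)
      have h0 := hα0 (M + j)
      rw [← add_assoc, Finset.sum_range_succ]
      have e1 : 1 - α (M + j) ≤ Real.exp (-α (M + j)) := by
        have := Real.add_one_le_exp (-α (M + j)); linarith
      set S := ∑ m ∈ Finset.range (M + j), α m - ∑ m ∈ Finset.range M, α m with hS
      have e2 : Real.exp (-(∑ m ∈ Finset.range (M + j), α m + α (M + j)
          - ∑ m ∈ Finset.range M, α m)) = Real.exp (-α (M + j)) * Real.exp (-S) := by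
        rw [← Real.exp_add]; congr 1; rw [hS]; ring
      rw [e2]
      have e3 : Z (M + j + 1) - η / 2 ≤ (1 - α (M + j)) * (Z (M + j) - η / 2) := by
        nlinarith [mul_le_mul_of_nonneg_right h3.le h0]
      have hpos : 0 ≤ Real.exp (-S) * Z M := mul_nonneg (Real.exp_pos _).le (hZ M)
      calc _ ≤ _ := e3
        _ ≤ (1 - α (M + j)) * (Real.exp (-S) * Z M) :=
          mul_le_mul_of_nonneg_left ih (by linarith)
        _ ≤ Real.exp (-α (M + j)) * (Real.exp (-S) * Z M) :=
          mul_le_mul_of_nonneg_right e1 hpos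
        _ = _ := by ring
  have hlim : Tendsto (fun j => Real.exp (-(∑ m ∈ Finset.range j, α m
      - ∑ m ∈ Finset.range M, α m)) * Z M) atTop (𝓝 0) := by
    have h1 : Tendsto (fun j => ∑ m ∈ Finset.range j, α m - ∑ m ∈ Finset.range M, α m)
        atTop atTop := tendsto_atTop_add_const_right _ _ hsum
    simpa using (Real.tendsto_exp_neg_atTop_nhds_zero.comp h1).mul_const (Z M)
  have hlim' := hlim.eventually (gt_mem_nhds (show (0 : ℝ) < η / 2 by linarith))
  obtain ⟨M', hM'⟩ := eventually_atTop.1 hlim'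
  refine ⟨max M M', fun m hm => ?_⟩
  obtain ⟨j, rfl⟩ := Nat.exists_eq_add_of_le (le_trans (le_max_left M M') hm)
  have := key j
  have h2 := hM' (M + j) (le_trans (le_max_right M M') hm)
  rw [Real.dist_eq, sub_zero, abs_of_nonneg (hZ _)]
  linarith

/-- A version of `tendsto_zero_of_contraction` that tolerates an expansion factor controlled by
the decrements of a nonincreasing nonnegative sequence. -/
theorem tendsto_zero_of_perturbed_contraction {Y α ε s : ℕ → ℝ} (hY : ∀ m, 0 ≤ Y m)
    (hα : ∀ᶠ m in atTop, α m ≤ 1) (hα0 : ∀ m, 0 ≤ α m)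
    (hsum : Tendsto (fun M => ∑ m ∈ Finset.range M, α m) atTop atTop)
    (hε0 : ∀ m, 0 ≤ ε m) (hε : Tendsto ε atTop (𝓝 0))
    (hs0 : ∀ m, 0 ≤ s m) (hs : Antitone s)
    (hrec : ∀ᶠ m in atTop,
      Y (m + 1) ≤ (1 - α m + (s m - s (m + 1))) * Y m + ε m * α m) :
    Tendsto Y atTop (𝓝 0) := by
  have hZ : Tendsto (fun m => Real.exp (2 * s m) * Y m) atTop (𝓝 0) := by
    refine tendsto_zero_of_contraction (α := fun m => α m / 2)
      (ε := fun m => 2 * Real.exp (2 * s 0) * ε m)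
      (fun m => mul_nonneg (Real.exp_pos _).le (hY m)) ?_ (fun m => by linarith [hα0 m]) ?_ ?_ ?_
    · filter_upwards [hα] with m hm
      linarith
    · simp_rw [← Finset.sum_div]
      exact hsum.atTop_div_const (by norm_num)
    · simpa using hε.const_mul (2 * Real.exp (2 * s 0))
    · filter_upwards [hα, hrec] with m h1 h2
      have h0 := hα0 m
      have hd : 0 ≤ s m - s (m + 1) := sub_nonneg.2 (hs (Nat.le_succ m))
      set δ := s m - s (m + 1) with hδ
      have e1 : Real.exp (2 * s (m + 1)) * (1 + 2 * δ) ≤ Real.exp (2 * s m) := by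
        have : Real.exp (2 * s m) = Real.exp (2 * s (m + 1)) * Real.exp (2 * δ) := by
          rw [← Real.exp_add]; congr 1; rw [hδ]; ring
        rw [this]
        refine mul_le_mul_of_nonneg_left ?_ (Real.exp_pos _).le
        have := Real.add_one_le_exp (2 * δ); linarith
      have e2 : 1 - α m + δ ≤ (1 + 2 * δ) * (1 - α m / 2) := by nlinarith
      have e3 : Real.exp (2 * s (m + 1)) ≤ Real.exp (2 * s 0) :=
        Real.exp_le_exp.2 (by linarith [hs (Nat.zero_le (m + 1))])
      have hp := (Real.exp_pos (2 * s (m + 1))).le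
      calc Real.exp (2 * s (m + 1)) * Y (m + 1)
          ≤ Real.exp (2 * s (m + 1)) * ((1 + 2 * δ) * (1 - α m / 2) * Y m + ε m * α m) :=
            mul_le_mul_of_nonneg_left
              (h2.trans (by linarith [mul_le_mul_of_nonneg_right e2 (hY m)])) hp
        _ = Real.exp (2 * s (m + 1)) * (1 + 2 * δ) * ((1 - α m / 2) * Y m)
            + Real.exp (2 * s (m + 1)) * (ε m * α m) := by ring
        _ ≤ Real.exp (2 * s m) * ((1 - α m / 2) * Y m)
            + Real.exp (2 * s 0) * (ε m * α m) :=
            add_le_add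
              (mul_le_mul_of_nonneg_right e1 (mul_nonneg (by linarith) (hY m)))
              (mul_le_mul_of_nonneg_right e3 (mul_nonneg (hε0 m) h0))
        _ = _ := by ring
  refine squeeze_zero hY (fun m => ?_) hZ
  have : 1 ≤ Real.exp (2 * s m) := Real.one_le_exp (by linarith [hs0 m])
  nlinarith [hY m]

section DelayEnergy

variable {E : Type*} [NormedAddCommGroup E]

/-- Exponentially discounted sum of the squared increments of a sequence. -/
noncomputable def incrementEnergy (y : ℕ → E) : ℕ → ℝ
  | 0 => 0
  | t + 1 => incrementEnergy y t / 2 + ‖y (t + 1) - y t‖ ^ 2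

/-- Squared norm plus discounted energy of the past increments. -/
noncomputable def delayEnergy (y : ℕ → E) (t : ℕ) : ℝ := ‖y t‖ ^ 2 + incrementEnergy y t

theorem incrementEnergy_nonneg (y : ℕ → E) (t : ℕ) : 0 ≤ incrementEnergy y t := by
  induction t with
  | zero => exact le_rfl
  | succ t ih => rw [incrementEnergy]; positivity

theorem delayEnergy_nonneg (y : ℕ → E) (t : ℕ) : 0 ≤ delayEnergy y t :=
  add_nonneg (sq_nonneg _) (incrementEnergy_nonneg y t)

theorem norm_sq_le_delayEnergy (y : ℕ → E) (t : ℕ) : ‖y t‖ ^ 2 ≤ delayEnergy y t :=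
  le_add_of_nonneg_right (incrementEnergy_nonneg y t)

theorem incrementEnergy_le_delayEnergy (y : ℕ → E) (t : ℕ) :
    incrementEnergy y t ≤ delayEnergy y t :=
  le_add_of_nonneg_left (sq_nonneg _)

theorem norm_sub_sq_le_incrementEnergy_add (y : ℕ → E) (t q : ℕ) :
    ‖y (t + q) - y t‖ ^ 2 ≤ 4 ^ q * incrementEnergy y (t + q) := by
  induction q with
  | zero => simpa using incrementEnergy_nonneg y t
  | succ q ih =>
    have h1 : y (t + (q + 1)) - y t = (y (t + q + 1) - y (t + q)) + (y (t + q) - y t) := by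
      rw [← add_assoc]; abel
    have h2 := norm_add_le (y (t + q + 1) - y (t + q)) (y (t + q) - y t)
    rw [h1, ← add_assoc, incrementEnergy, pow_succ (4 : ℝ)]
    set u := ‖y (t + q + 1) - y (t + q)‖
    set v := ‖y (t + q) - y t‖
    have hu : 0 ≤ u := norm_nonneg _
    have h3 : ‖(y (t + q + 1) - y (t + q)) + (y (t + q) - y t)‖ ^ 2 ≤ (u + v) ^ 2 :=
      pow_le_pow_left₀ (norm_nonneg _) h2 2
    have h4 : (1 : ℝ) ≤ 4 ^ q := one_le_pow₀ (by norm_num)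
    nlinarith [sq_nonneg (u - v), mul_le_mul_of_nonneg_right h4 (sq_nonneg u)]

theorem norm_sum_sq_le {ι : Type*} (s : Finset ι) (f : ι → E) :
    ‖∑ i ∈ s, f i‖ ^ 2 ≤ s.card * ∑ i ∈ s, ‖f i‖ ^ 2 :=
  (pow_le_pow_left₀ (norm_nonneg _) (norm_sum_le s f) 2).trans sq_sum_le_card_mul_sum_sq

theorem norm_add_three_sq_le (u v w : E) :
    ‖u + v + w‖ ^ 2 ≤ 3 * (‖u‖ ^ 2 + ‖v‖ ^ 2 + ‖w‖ ^ 2) := by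
  have h := pow_le_pow_left₀ (norm_nonneg _) (norm_add₃_le (a := u) (b := v) (c := w)) 2
  nlinarith [sq_nonneg (‖u‖ - ‖v‖), sq_nonneg (‖u‖ - ‖w‖), sq_nonneg (‖v‖ - ‖w‖)]

variable [InnerProductSpace ℝ E]

/-- One step of a linear recursion with drift `G`, delay perturbation `D` and input `w`, where
drift and delay perturbation have size `β`. -/
structure DelayStep (y D w : ℕ → E) (G : ℕ → E →ₗ[ℝ] E) (β : ℝ) (t : ℕ) : Prop where
  step : y (t + 1) = y t - G t (y t) + D t + w t
  drift_le : ∀ z, ‖G t z‖ ≤ β * ‖z‖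
  delay_le : ‖D t‖ ^ 2 ≤ β ^ 2 * incrementEnergy y t

variable {y D w : ℕ → E} {G : ℕ → E →ₗ[ℝ] E} {β B : ℝ}

theorem DelayStep.norm_increment_sq_le {t : ℕ} (hs : DelayStep y D w G β t) :
    ‖y (t + 1) - y t‖ ^ 2 ≤ 3 * (β ^ 2 * delayEnergy y t + ‖w t‖ ^ 2) := by
  have h1 : y (t + 1) - y t = -G t (y t) + D t + w t := by rw [hs.step]; abel
  have h2 := norm_add_three_sq_le (-G t (y t)) (D t) (w t)
  have h3 := pow_le_pow_left₀ (norm_nonneg _) (hs.drift_le (y t)) 2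
  rw [norm_neg] at h2
  rw [h1, delayEnergy]
  nlinarith [hs.delay_le]

theorem DelayStep.delayEnergy_succ_le {t : ℕ} (hs : DelayStep y D w G β t) (hβ : 0 ≤ β)
    (hβB : β ≤ B) :
    delayEnergy y (t + 1) ≤ (9 + 9 * B ^ 2) * (delayEnergy y t + ‖w t‖ ^ 2) := by
  have h1 := hs.norm_increment_sq_le
  have h2 : ‖y (t + 1)‖ ^ 2 ≤ 2 * ‖y t‖ ^ 2 + 2 * ‖y (t + 1) - y t‖ ^ 2 := by
    have := norm_add_le (y t) (y (t + 1) - y t)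
    rw [add_sub_cancel] at this
    nlinarith [sq_nonneg (‖y t‖ - ‖y (t + 1) - y t‖), norm_nonneg (y (t + 1))]
  have h3 : β ^ 2 ≤ B ^ 2 := pow_le_pow_left₀ hβ hβB 2
  have h4 := delayEnergy_nonneg y t
  have h5 := incrementEnergy_nonneg y t
  have h6 := mul_le_mul_of_nonneg_right h3 h4
  have h7 : 0 ≤ B ^ 2 * ‖w t‖ ^ 2 := by positivity
  have h8 : delayEnergy y t = ‖y t‖ ^ 2 + incrementEnergy y t := rfl
  rw [delayEnergy, incrementEnergy]
  nlinarith [sq_nonneg ‖y t‖, sq_nonneg ‖w t‖]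

theorem delayEnergy_add_le {τ : ℕ} (hβ : 0 ≤ β) (hβB : β ≤ B) (j : ℕ)
    (hs : ∀ i < j, DelayStep y D w G β (τ + i)) :
    delayEnergy y (τ + j) ≤
      (9 + 9 * B ^ 2) ^ j * (delayEnergy y τ + ∑ i ∈ Finset.range j, ‖w (τ + i)‖ ^ 2) := by
  induction j with
  | zero => simp
  | succ j ih =>
    have h1 := (hs j (by omega)).delayEnergy_succ_le hβ hβB
    have h2 := ih fun i hi => hs i (by omega)
    have h3 : (1 : ℝ) ≤ (9 + 9 * B ^ 2) ^ j := one_le_pow₀ (by nlinarith [sq_nonneg B])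
    rw [← add_assoc, Finset.sum_range_succ, pow_succ']
    refine h1.trans ?_
    rw [mul_assoc]
    refine mul_le_mul_of_nonneg_left ?_ (by positivity)
    nlinarith [mul_le_mul_of_nonneg_right h3 (sq_nonneg ‖w (τ + j)‖)]

theorem incrementEnergy_add_le {τ h : ℕ} (hβ : 0 ≤ β) (hβB : β ≤ B)
    (hs : ∀ i < h, DelayStep y D w G β (τ + i)) (j : ℕ) (hj : j ≤ h) :
    incrementEnergy y (τ + j) ≤ (1 / 2) ^ j * incrementEnergy y τ
      + j * (3 * (9 + 9 * B ^ 2) ^ h * (1 + B ^ 2)) *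
        (β ^ 2 * delayEnergy y τ + ∑ i ∈ Finset.range h, ‖w (τ + i)‖ ^ 2) := by
  induction j with
  | zero => simp
  | succ j ih =>
    have h1 := (hs j (by omega)).norm_increment_sq_le
    have h2 := delayEnergy_add_le hβ hβB j fun i hi => hs i (by omega)
    have h3 := ih (by omega)
    set W := ∑ i ∈ Finset.range h, ‖w (τ + i)‖ ^ 2 with hW
    have hW0 : 0 ≤ W := Finset.sum_nonneg fun i _ => sq_nonneg _
    have h4 : ∑ i ∈ Finset.range j, ‖w (τ + i)‖ ^ 2 ≤ W :=
      Finset.sum_le_sum_of_subset_of_nonneg (Finset.range_mono (by omega))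
        fun i _ _ => sq_nonneg _
    have h5 : ‖w (τ + j)‖ ^ 2 ≤ W :=
      Finset.single_le_sum (f := fun i => ‖w (τ + i)‖ ^ 2) (fun i _ => sq_nonneg _)
        (Finset.mem_range.2 (by omega))
    have hb : (1 : ℝ) ≤ 9 + 9 * B ^ 2 := by nlinarith [sq_nonneg B]
    set P := (9 + 9 * B ^ 2) ^ h
    have h6 : (9 + 9 * B ^ 2) ^ j ≤ P := pow_le_pow_right₀ hb (by omega)
    have hP : 1 ≤ P := one_le_pow₀ hb
    have hφ := delayEnergy_nonneg y τ
    have h7 : delayEnergy y (τ + j) ≤ P * (delayEnergy y τ + W) :=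
      h2.trans (mul_le_mul h6 (by linarith)
        (add_nonneg hφ (Finset.sum_nonneg fun i _ => sq_nonneg _)) (by linarith))
    have h8 : β ^ 2 ≤ B ^ 2 := pow_le_pow_left₀ hβ hβB 2
    have h9 : β ^ 2 * delayEnergy y (τ + j) ≤ P * (β ^ 2 * delayEnergy y τ + B ^ 2 * W) := by
      have := mul_le_mul_of_nonneg_left h7 (sq_nonneg β)
      have h10 := mul_le_mul_of_nonneg_right h8 (mul_nonneg (zero_le_one.trans hP) hW0)
      nlinarith
    have h10 : 3 * (β ^ 2 * delayEnergy y (τ + j) + ‖w (τ + j)‖ ^ 2)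
        ≤ 3 * P * (1 + B ^ 2) * (β ^ 2 * delayEnergy y τ + W) := by
      have e1 : W ≤ P * W := le_mul_of_one_le_left hW0 hP
      have e2 : 0 ≤ P * (B ^ 2 * (β ^ 2 * delayEnergy y τ)) := by positivity
      nlinarith
    have h11 : 0 ≤ (j : ℝ) * (3 * P * (1 + B ^ 2)) * (β ^ 2 * delayEnergy y τ + W) := by
      positivity
    rw [← add_assoc, incrementEnergy, pow_succ (1 / 2 : ℝ)]
    push_cast
    linarith

theorem two_mul_le_of_sq_le_mul {p r k q c : ℝ} (hk : 0 ≤ k) (hq : 0 ≤ q) (hc : 0 ≤ c)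
    (hp : p ^ 2 ≤ c) (hr : r ^ 2 ≤ k * q) : 2 * (p * r) ≤ 8 * (k * c) + q / 8 := by
  have h1 : p ^ 2 * r ^ 2 ≤ c * (k * q) := mul_le_mul hp hr (sq_nonneg _) hc
  have h2 : (2 * (p * r)) ^ 2 ≤ (8 * (k * c) + q / 8) ^ 2 := by
    nlinarith [sq_nonneg (8 * (k * c) - q / 8)]
  exact (abs_le_of_sq_le_sq' h2 (by positivity)).2

/-- Change of the delay energy over a window of length `h`. -/
theorem exists_delayEnergy_window_le (E : Type*) [NormedAddCommGroup E] [InnerProductSpace ℝ E]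
    (h : ℕ) (hh : 1 ≤ h) (B : ℝ) :
    ∃ K : ℝ, 0 ≤ K ∧ ∀ (y D w : ℕ → E) (G : ℕ → E →ₗ[ℝ] E) (β : ℝ) (τ : ℕ), 0 ≤ β → β ≤ B →
      (∀ i < h, DelayStep y D w G β (τ + i)) →
      delayEnergy y (τ + h) ≤ delayEnergy y τ - 3 / 8 * incrementEnergy y τ
        - 2 * ∑ i ∈ Finset.range h, inner ℝ (y τ) (G (τ + i) (y τ))
        + 2 * ∑ i ∈ Finset.range h, inner ℝ (y τ) (w (τ + i))
        + K * β ^ 2 * delayEnergy y τ + K * ∑ i ∈ Finset.range h, ‖w (τ + i)‖ ^ 2 := by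
  set C : ℝ := h * (3 * (9 + 9 * B ^ 2) ^ h * (1 + B ^ 2)) with hC
  have hC0 : 0 ≤ C := by positivity
  set K₁ : ℝ := h * (h * (2 * (4 ^ h + 1))) with hK₁
  have hK₁0 : 0 ≤ K₁ := by positivity
  refine ⟨C + 3 * (h * h + h + K₁ * (1 + B ^ 2) * (1 + C)) + 8 * K₁ + C,
    by positivity, fun y D w G β τ hβ hβB hs => ?_⟩
  set W := ∑ i ∈ Finset.range h, ‖w (τ + i)‖ ^ 2 with hW
  have hW0 : 0 ≤ W := Finset.sum_nonneg fun i _ => sq_nonneg _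
  set J := incrementEnergy y τ with hJ
  have hJ0 : 0 ≤ J := incrementEnergy_nonneg y τ
  set φ := delayEnergy y τ with hφ
  have hφ0 : 0 ≤ φ := delayEnergy_nonneg y τ
  set Q := J + C * (β ^ 2 * φ + W) with hQ
  have hQ0 : 0 ≤ Q := by positivity
  have hP0 : 0 ≤ 3 * (9 + 9 * B ^ 2) ^ h * (1 + B ^ 2) := by positivity
  have hinc : ∀ j ≤ h, incrementEnergy y (τ + j) ≤ (1 / 2) ^ j * J + C * (β ^ 2 * φ + W) := by
    intro j hj
    refine (incrementEnergy_add_le hβ hβB hs j hj).trans ?_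
    have : (j : ℝ) * (3 * (9 + 9 * B ^ 2) ^ h * (1 + B ^ 2)) ≤ C :=
      mul_le_mul_of_nonneg_right (by exact_mod_cast hj) hP0
    have := mul_le_mul_of_nonneg_right this (show 0 ≤ β ^ 2 * φ + W by positivity)
    linarith
  have hincQ : ∀ j ≤ h, incrementEnergy y (τ + j) ≤ Q := by
    intro j hj
    have h1 : ((1 : ℝ) / 2) ^ j * J ≤ J :=
      mul_le_of_le_one_left hJ0 (pow_le_one₀ (by norm_num) (by norm_num))
    linarith [hinc j hj]
  have hend : incrementEnergy y (τ + h) ≤ J / 2 + C * (β ^ 2 * φ + W) := by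
    have h1 : ((1 : ℝ) / 2) ^ h ≤ 1 / 2 := by
      simpa using pow_le_pow_of_le_one (by norm_num : (0 : ℝ) ≤ 1 / 2) (by norm_num) hh
    nlinarith [hinc h le_rfl, mul_le_mul_of_nonneg_right h1 hJ0]
  set r : ℕ → E := fun i => -(G (τ + i) (y (τ + i) - y τ)) + D (τ + i) with hr
  have hr_le : ∀ i ∈ Finset.range h, ‖r i‖ ^ 2 ≤ 2 * (4 ^ h + 1) * (β ^ 2 * Q) := by
    intro i hi
    have hi' := Finset.mem_range.1 hi
    have h1 := norm_add_le (-(G (τ + i) (y (τ + i) - y τ))) (D (τ + i))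
    rw [norm_neg] at h1
    have h2 := pow_le_pow_left₀ (norm_nonneg _) ((hs i hi').drift_le (y (τ + i) - y τ)) 2
    have h3 := (hs i hi').delay_le
    have h4 := hincQ i hi'.le
    have h5 := norm_sub_sq_le_incrementEnergy_add y τ i
    have h6 : (4 : ℝ) ^ i ≤ 4 ^ h := pow_le_pow_right₀ (by norm_num) hi'.le
    have h7 : ‖y (τ + i) - y τ‖ ^ 2 ≤ 4 ^ h * Q :=
      h5.trans (mul_le_mul h6 h4 (incrementEnergy_nonneg _ _) (by positivity))
    have h8 := mul_le_mul_of_nonneg_left h7 (sq_nonneg β)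
    have h9 := mul_le_mul_of_nonneg_left h4 (sq_nonneg β)
    have h10 := pow_le_pow_left₀ (norm_nonneg _) h1 2
    nlinarith [sq_nonneg (‖G (τ + i) (y (τ + i) - y τ)‖ - ‖D (τ + i)‖)]
  set R := ∑ i ∈ Finset.range h, r i with hR
  have hR_le : ‖R‖ ^ 2 ≤ K₁ * (β ^ 2 * Q) := by
    have h1 := norm_sum_sq_le (Finset.range h) r
    have h2 := Finset.sum_le_sum hr_le
    rw [Finset.sum_const, Finset.card_range, nsmul_eq_mul] at h2
    rw [Finset.card_range] at h1
    refine h1.trans ((mul_le_mul_of_nonneg_left h2 (Nat.cast_nonneg h)).trans (le_of_eq ?_))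
    rw [hK₁]; ring
  set U := ∑ i ∈ Finset.range h, G (τ + i) (y τ) with hU
  have hU_le : ‖U‖ ^ 2 ≤ h * h * (β ^ 2 * φ) := by
    have h1 := norm_sum_sq_le (Finset.range h) fun i => G (τ + i) (y τ)
    have h2 : ∀ i ∈ Finset.range h, ‖G (τ + i) (y τ)‖ ^ 2 ≤ β ^ 2 * φ := by
      intro i hi
      have h3 := pow_le_pow_left₀ (norm_nonneg _)
        ((hs i (Finset.mem_range.1 hi)).drift_le (y τ)) 2
      have h4 := mul_le_mul_of_nonneg_left (norm_sq_le_delayEnergy y τ) (sq_nonneg β)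
      nlinarith
    have h2 := Finset.sum_le_sum h2
    rw [Finset.sum_const, Finset.card_range, nsmul_eq_mul] at h2
    rw [Finset.card_range] at h1
    refine h1.trans ((mul_le_mul_of_nonneg_left h2 (Nat.cast_nonneg h)).trans (le_of_eq ?_))
    ring
  set V := ∑ i ∈ Finset.range h, w (τ + i) with hV
  have hV_le : ‖V‖ ^ 2 ≤ h * W := by
    have h1 := norm_sum_sq_le (Finset.range h) fun i => w (τ + i)
    rwa [Finset.card_range] at h1
  have hy : y (τ + h) = y τ + (-U + V + R) := by
    have h1 : y (τ + h) - y τ = ∑ i ∈ Finset.range h, (y (τ + i + 1) - y (τ + i)) := by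
      have := Finset.sum_range_sub (fun i => y (τ + i)) h
      simpa [add_assoc] using this.symm
    rw [← sub_eq_iff_eq_add', h1, hU, hV, hR, ← Finset.sum_neg_distrib, ← Finset.sum_add_distrib,
      ← Finset.sum_add_distrib]
    refine Finset.sum_congr rfl fun i hi => ?_
    rw [(hs i (Finset.mem_range.1 hi)).step, hr]
    simp only [map_sub]
    abel
  have hsq := norm_add_sq_real (y τ) (-U + V + R)
  have h3 := norm_add_three_sq_le (-U) V R
  rw [norm_neg] at h3
  have hin : inner ℝ (y τ) (-U + V + R) = -inner ℝ (y τ) U + inner ℝ (y τ) V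
      + inner ℝ (y τ) R := by
    rw [inner_add_right, inner_add_right, inner_neg_right]
  have hyR : 2 * inner ℝ (y τ) R ≤ 8 * K₁ * (β ^ 2 * φ) + Q / 8 := by
    have h1 : inner ℝ (y τ) R ≤ ‖y τ‖ * ‖R‖ := real_inner_le_norm _ _
    have h2 := two_mul_le_of_sq_le_mul (mul_nonneg hK₁0 (sq_nonneg β)) hQ0 hφ0
      (norm_sq_le_delayEnergy y τ) (hR_le.trans_eq (mul_assoc _ _ _).symm)
    linarith
  have hUi : inner ℝ (y τ) U = ∑ i ∈ Finset.range h, inner ℝ (y τ) (G (τ + i) (y τ)) := by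
    rw [hU, inner_sum]
  have hVi : inner ℝ (y τ) V = ∑ i ∈ Finset.range h, inner ℝ (y τ) (w (τ + i)) := by
    rw [hV, inner_sum]
  rw [← hUi, ← hVi]
  have hKQ : K₁ * (β ^ 2 * Q) ≤ K₁ * (1 + B ^ 2) * (1 + C) * (β ^ 2 * φ + W) := by
    have e1 : β ^ 2 ≤ B ^ 2 := pow_le_pow_left₀ hβ hβB 2
    have e2 : β ^ 2 * J ≤ β ^ 2 * φ :=
      mul_le_mul_of_nonneg_left (incrementEnergy_le_delayEnergy y τ) (sq_nonneg β)
    have hM : 0 ≤ β ^ 2 * φ + W := by positivity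
    have e3 : β ^ 2 * (C * (β ^ 2 * φ + W)) ≤ B ^ 2 * (C * (β ^ 2 * φ + W)) :=
      mul_le_mul_of_nonneg_right e1 (by positivity)
    have e4 : β ^ 2 * Q ≤ (1 + B ^ 2) * (1 + C) * (β ^ 2 * φ + W) := by
      have e5 : 0 ≤ B ^ 2 * (β ^ 2 * φ + W) := by positivity
      have e6 : 0 ≤ C * (β ^ 2 * φ + W) := by positivity
      rw [hQ]
      linarith
    linarith [mul_le_mul_of_nonneg_left e4 hK₁0]
  have hφJ : φ = ‖y τ‖ ^ 2 + J := rfl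
  have hend' : delayEnergy y (τ + h) = ‖y (τ + h)‖ ^ 2 + incrementEnergy y (τ + h) := rfl
  have n1 : 0 ≤ (h : ℝ) * (β ^ 2 * φ) := by positivity
  have n2 : 0 ≤ (h : ℝ) * h * W := by positivity
  have n3 : 0 ≤ K₁ * W := by positivity
  have n4 : 0 ≤ C * (β ^ 2 * φ + W) := by positivity
  rw [hend', hy, hsq, hin]
  linarith

end DelayEnergy

section CondExp

variable {Ω : Type*} {m0 : MeasurableSpace Ω} {μ : Measure Ω} [IsProbabilityMeasure μ]

theorem setIntegral_inter_eq_zero_of_indep {mX mG : MeasurableSpace Ω} (hX : mX ≤ m0)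
    (hG : mG ≤ m0) (hind : ProbabilityTheory.Indep mX mG μ) {f : Ω → ℝ}
    (hf : StronglyMeasurable[mX] f) (hfi : Integrable f μ) {s t : Set Ω}
    (hs : MeasurableSet[mX] s) (hs0 : ∫ ω in s, f ω ∂μ = 0) (ht : MeasurableSet[mG] t) :
    ∫ ω in s ∩ t, f ω ∂μ = 0 := by
  have h1 := condExp_indep_eq hX hG (hf.indicator hs) hind
  have h2 := setIntegral_condExp hG (hfi.indicator (hX s hs)) ht
  rw [integral_indicator (hX s hs), hs0] at h1
  rw [setIntegral_indicator (hX s hs), Set.inter_comm] at h2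
  rw [← h2]
  rw [setIntegral_congr_ae (hG t ht) (h1.mono fun ω h _ => h)]
  simp

/-- If `f` has zero conditional mean given `mV`, then it still has zero conditional mean after
`mV` is enlarged by a σ-algebra independent of both `f` and `mV`. -/
theorem condExp_sup_eq_zero_of_indep {mX mV mG : MeasurableSpace Ω} (hX : mX ≤ m0)
    (hVX : mV ≤ mX) (hG : mG ≤ m0) (hind : ProbabilityTheory.Indep mX mG μ) {f : Ω → ℝ}
    (hf : StronglyMeasurable[mX] f) (hfi : Integrable f μ)
    (h0 : ∀ s, MeasurableSet[mV] s → ∫ ω in s, f ω ∂μ = 0) :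
    μ[f|mV ⊔ mG] =ᵐ[μ] 0 := by
  have hle : mV ⊔ mG ≤ m0 := sup_le (hVX.trans hX) hG
  have key : ∀ s, MeasurableSet[mV ⊔ mG] s → ∫ ω in s, f ω ∂μ = 0 := by
    refine MeasurableSpace.induction_on_inter (m := mV ⊔ mG)
      (C := fun s _ => ∫ ω in s, f ω ∂μ = 0)
      (s := {u | ∃ s t, MeasurableSet[mV] s ∧ MeasurableSet[mG] t ∧ u = s ∩ t}) ?_ ?_ ?_ ?_ ?_ ?_
    · refine le_antisymm (sup_le ?_ ?_) (MeasurableSpace.generateFrom_le ?_)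
      · intro s hs
        exact MeasurableSpace.measurableSet_generateFrom
          ⟨s, Set.univ, hs, MeasurableSet.univ, by simp⟩
      · intro t ht
        exact MeasurableSpace.measurableSet_generateFrom
          ⟨Set.univ, t, MeasurableSet.univ, ht, by simp⟩
      · rintro u ⟨s, t, hs, ht, rfl⟩
        exact MeasurableSet.inter (le_sup_left (a := mV) (b := mG) s hs)
          (le_sup_right (a := mV) (b := mG) t ht)
    · rintro _ ⟨s, t, hs, ht, rfl⟩ _ ⟨s', t', hs', ht', rfl⟩ -
      exact ⟨s ∩ s', t ∩ t', hs.inter hs', ht.inter ht', Set.inter_inter_inter_comm _ _ _ _⟩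
    · simp
    · rintro u ⟨s, t, hs, ht, rfl⟩
      exact setIntegral_inter_eq_zero_of_indep hX hG hind hf hfi (hVX s hs) (h0 s hs) ht
    · intro s hs h
      have hfull : ∫ ω, f ω ∂μ = 0 := by simpa using h0 Set.univ MeasurableSet.univ
      have := integral_add_compl (hle s hs) hfi
      linarith
    · intro g hg hgm h
      rw [integral_iUnion (fun i => hle _ (hgm i)) hg hfi.integrableOn]
      simp [h]
  refine (ae_eq_condExp_of_forall_setIntegral_eq hle hfi (fun s _ _ => integrableOn_zero)
    (fun s hs _ => ?_) stronglyMeasurable_zero.aestronglyMeasurable).symm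
  rw [key s hs]
  simp

theorem integral_mul_eq_zero_of_condExp_eq_zero {m : MeasurableSpace Ω} (hm : m ≤ m0)
    {f g : Ω → ℝ} (hf : StronglyMeasurable[m] f) (hg : Integrable g μ)
    (hfg : Integrable (fun ω => f ω * g ω) μ) (h0 : μ[g|m] =ᵐ[μ] 0) :
    ∫ ω, f ω * g ω ∂μ = 0 := by
  have h1 := condExp_mul_of_stronglyMeasurable_left hf hfg hg
  rw [← integral_condExp hm]
  rw [integral_congr_ae (g := fun _ => (0 : ℝ)) ?_]
  · simp
  · refine h1.trans ?_
    filter_upwards [h0] with ω hω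
    simp [hω]

theorem integral_mul_condExp {m : MeasurableSpace Ω} (hm : m ≤ m0)
    {f g : Ω → ℝ} (hf : StronglyMeasurable[m] f) (hg : Integrable g μ)
    (hfg : Integrable (fun ω => f ω * g ω) μ) :
    Integrable (fun ω => f ω * (μ[g|m]) ω) μ ∧
      ∫ ω, f ω * (μ[g|m]) ω ∂μ = ∫ ω, f ω * g ω ∂μ := by
  have h1 := condExp_mul_of_stronglyMeasurable_left hf hfg hg
  refine ⟨(integrable_condExp (m := m) (f := f * g)).congr h1, ?_⟩
  rw [← integral_condExp hm (f := fun ω => f ω * g ω)]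
  exact (integral_congr_ae h1).symm

end CondExp

section MatrixBounds

theorem norm_toEuclideanLin_le {ι : Type*} [Fintype ι] [DecidableEq ι] (M : Matrix ι ι ℝ) {c : ℝ}
    (hc : 0 ≤ c) (hM : ∀ i j, |M i j| ≤ c) (z : EuclideanSpace ℝ ι) :
    ‖Matrix.toEuclideanLin M z‖ ≤ Fintype.card ι * c * ‖z‖ := by
  refine le_of_sq_le_sq ?_ (by positivity)
  rw [EuclideanSpace.real_norm_sq_eq, mul_pow, EuclideanSpace.real_norm_sq_eq z]
  have h1 : ∀ i ∈ (Finset.univ : Finset ι), (Matrix.toEuclideanLin M z i) ^ 2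
      ≤ Fintype.card ι * c ^ 2 * ∑ j, z j ^ 2 := by
    intro i _
    rw [Matrix.toLpLin_apply]
    refine (Finset.sum_mul_sq_le_sq_mul_sq _ _ _).trans ?_
    refine mul_le_mul_of_nonneg_right ?_ (Finset.sum_nonneg fun j _ => sq_nonneg _)
    refine (Finset.sum_le_sum (g := fun _ => c ^ 2) fun j _ => ?_).trans (by simp)
    exact sq_le_sq' (by linarith [(abs_le.1 (hM i j)).1]) (abs_le.1 (hM i j)).2
  refine (Finset.sum_le_sum h1).trans (le_of_eq ?_)
  simp
  ring

theorem abs_apply_le_specNorm {p q : Type*} [Fintype p] [Fintype q] [DecidableEq q]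
    (M : Matrix p q ℝ) (i : p) (j : q) : |M i j| ≤ specNorm M := by
  have h1 := (LinearMap.toContinuousLinearMap (Matrix.toEuclideanLin M)).le_opNorm
    (EuclideanSpace.single j 1)
  have h2 := PiLp.norm_apply_le (LinearMap.toContinuousLinearMap (Matrix.toEuclideanLin M)
    (EuclideanSpace.single j 1)) i
  rw [PiLp.norm_single, norm_one, mul_one] at h1
  refine le_trans (le_of_eq ?_) (h2.trans h1)
  simp [Matrix.toLpLin_apply, Real.norm_eq_abs]

theorem specNorm_nonneg {p q : Type*} [Fintype p] [Fintype q] [DecidableEq q]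
    (M : Matrix p q ℝ) : 0 ≤ specNorm M := norm_nonneg _

theorem lambdaMin_mul_sum_sq_le {p : Type*} [Fintype p] (M : Matrix p p ℝ) (z : p → ℝ) :
    lambdaMin M * ∑ i, z i ^ 2 ≤ z ⬝ᵥ M *ᵥ z := by
  classical
  have hS : 0 ≤ ∑ i, z i ^ 2 := Finset.sum_nonneg fun i _ => sq_nonneg _
  rcases hS.eq_or_lt with h0 | h0
  · have hz : z = 0 := by
      ext i
      have := (Finset.sum_eq_zero_iff_of_nonneg fun i _ => sq_nonneg (z i)).1 h0.symm i
        (Finset.mem_univ i)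
      simpa using this
    simp [hz]
  · set r := Real.sqrt (∑ i, z i ^ 2) with hr
    have hr0 : 0 < r := Real.sqrt_pos.2 h0
    have hr2 : r ^ 2 = ∑ i, z i ^ 2 := Real.sq_sqrt hS
    have hu : ∑ i, (r⁻¹ • z) i ^ 2 = 1 := by
      simp only [Pi.smul_apply, smul_eq_mul, mul_pow]
      rw [← Finset.mul_sum, ← hr2]
      field_simp
    have hb : BddBelow (Set.range fun x : {x : p → ℝ // ∑ i, x i ^ 2 = 1} =>
        dotProduct x.1 (M.mulVec x.1)) := by
      refine ⟨-∑ i, ∑ j, |M i j|, ?_⟩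
      rintro _ ⟨⟨x, hx⟩, rfl⟩
      have hx1 : ∀ i, |x i| ≤ 1 := fun i => by
        rw [← sq_le_one_iff_abs_le_one, ← hx]
        exact Finset.single_le_sum (f := fun i => x i ^ 2) (fun i _ => sq_nonneg _)
          (Finset.mem_univ i)
      change -∑ i, ∑ j, |M i j| ≤ ∑ i, x i * (M *ᵥ x) i
      rw [neg_le, ← Finset.sum_neg_distrib]
      refine Finset.sum_le_sum fun i _ => ?_
      rw [Matrix.mulVec, dotProduct, Finset.mul_sum, ← Finset.sum_neg_distrib]
      refine Finset.sum_le_sum fun j _ => ?_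
      refine (neg_le_abs _).trans ?_
      rw [abs_mul, abs_mul]
      calc |x i| * (|M i j| * |x j|) ≤ 1 * (|M i j| * 1) := by
            gcongr
            · exact hx1 i
            · exact hx1 j
        _ = |M i j| := by ring
    have h1 : lambdaMin M ≤ (r⁻¹ • z) ⬝ᵥ M *ᵥ (r⁻¹ • z) := ciInf_le hb ⟨r⁻¹ • z, hu⟩
    rw [Matrix.mulVec_smul, smul_dotProduct, dotProduct_smul, smul_eq_mul, smul_eq_mul] at h1
    rw [← hr2]
    calc lambdaMin M * r ^ 2 ≤ (r⁻¹ * (r⁻¹ * (z ⬝ᵥ M *ᵥ z))) * r ^ 2 :=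
          mul_le_mul_of_nonneg_right h1 (sq_nonneg r)
      _ = z ⬝ᵥ M *ᵥ z := by field_simp

end MatrixBounds

section Model

variable {N n : ℕ} {ni : Fin N → ℕ}

/-- The delay-free drift matrix `bℒ ⊗ I + aℋᵀℋ`. -/
noncomputable def driftMat (a b : ℝ) (A : Matrix (Fin N) (Fin N) ℝ)
    (H : ∀ i : Fin N, Matrix (Fin (ni i)) (Fin n) ℝ) :
    Matrix (Fin N × Fin n) (Fin N × Fin n) ℝ :=
  b • (lapl A ⊗ₖ (1 : Matrix (Fin n) (Fin n) ℝ)) + a • blockHtH H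

/-- The stacked observation noise `aℋᵀv`. -/
noncomputable def noiseVec (a : ℝ) (H : ∀ i : Fin N, Matrix (Fin (ni i)) (Fin n) ℝ)
    (v : ∀ i : Fin N, Fin (ni i) → ℝ) : EuclideanSpace ℝ (Fin N × Fin n) :=
  WithLp.toLp 2 fun p => a * ∑ r, H p.1 r p.2 * v p.1 r

/-- The perturbation caused by the delays `lam` at time `t` along the trajectory `y`. -/
noncomputable def delayVec (b : ℝ) (A : Matrix (Fin N) (Fin N) ℝ) (lam : Fin N → Fin N → ℕ)
    (y : ℕ → EuclideanSpace ℝ (Fin N × Fin n)) (t : ℕ) : EuclideanSpace ℝ (Fin N × Fin n) :=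
  WithLp.toLp 2 fun p => b * ∑ j, A p.1 j * (y (t - lam j p.1) (j, p.2) - y t (j, p.2))

/-- The stacked estimation error at time `t - d`. -/
noncomputable def errVec (x : ℤ → Fin N → Fin n → ℝ) (x0 : Fin n → ℝ) (d t : ℕ) :
    EuclideanSpace ℝ (Fin N × Fin n) :=
  WithLp.toLp 2 fun p => x ((t : ℤ) - d) p.1 p.2 - x0 p.2

theorem lapl_kronecker_mulVec_apply (A : Matrix (Fin N) (Fin N) ℝ) (z : Fin N × Fin n → ℝ)
    (p : Fin N × Fin n) :
    ((lapl A ⊗ₖ (1 : Matrix (Fin n) (Fin n) ℝ)) *ᵥ z) p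
      = ∑ j, A p.1 j * (z p - z (j, p.2)) := by
  obtain ⟨i, c⟩ := p
  have h1 : ((lapl A ⊗ₖ (1 : Matrix (Fin n) (Fin n) ℝ)) *ᵥ z) (i, c)
      = ∑ j, lapl A i j * z (j, c) := by
    simp only [Matrix.mulVec, dotProduct, Fintype.sum_prod_type, Matrix.kroneckerMap_apply,
      Matrix.one_apply]
    refine Finset.sum_congr rfl fun j _ => ?_
    simp
  rw [h1]
  simp only [lapl, degMat, Matrix.sub_apply, Matrix.diagonal_apply, sub_mul, mul_sub,
    Finset.sum_sub_distrib, ite_mul, zero_mul, Finset.sum_ite_eq, Finset.mem_univ, if_true,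
    Finset.sum_mul]

theorem blockHtH_mulVec_apply (H : ∀ i : Fin N, Matrix (Fin (ni i)) (Fin n) ℝ)
    (z : Fin N × Fin n → ℝ) (p : Fin N × Fin n) :
    (blockHtH H *ᵥ z) p = ((H p.1)ᵀ *ᵥ (H p.1 *ᵥ fun c => z (p.1, c))) p.2 := by
  obtain ⟨i, c⟩ := p
  rw [Matrix.mulVec_mulVec]
  simp only [blockHtH, Matrix.mulVec, dotProduct, Fintype.sum_prod_type, Matrix.of_apply]
  rw [Finset.sum_eq_single i]
  · simp
  · intro j _ hj
    simp [hj.symm]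
  · simp

theorem errVec_succ {d k : ℕ} {a b : ℝ} {A : Matrix (Fin N) (Fin N) ℝ}
    {H : ∀ i : Fin N, Matrix (Fin (ni i)) (Fin n) ℝ} {v : ∀ i : Fin N, Fin (ni i) → ℝ}
    {lam : Fin N → Fin N → ℕ} (hlam : ∀ j i, lam j i ≤ d) {x : ℤ → Fin N → Fin n → ℝ}
    {x0 : Fin n → ℝ}
    (hrec : ∀ i, x ((k : ℤ) + 1) i = fun p =>
      x (k : ℤ) i p
        + a * ((H i)ᵀ.mulVec (((H i).mulVec x0 + v i) - (H i).mulVec (x (k : ℤ) i))) p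
        + b * ∑ j, A i j * (x ((k : ℤ) - (lam j i : ℤ)) j p - x (k : ℤ) i p)) :
    errVec x x0 d (d + k + 1) = errVec x x0 d (d + k)
      - Matrix.toEuclideanLin (driftMat a b A H) (errVec x x0 d (d + k))
      + delayVec b A lam (errVec x x0 d) (d + k) + noiseVec a H v := by
  ext ⟨i, c⟩
  have ht : ((d + k : ℕ) : ℤ) - d = k := by push_cast; ring
  have ht1 : ((d + k + 1 : ℕ) : ℤ) - d = k + 1 := by push_cast; ring
  have htl : ∀ j, ((d + k - lam j i : ℕ) : ℤ) - d = k - lam j i := fun j => by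
    rw [Nat.cast_sub (by have := hlam j i; omega)]; push_cast; ring
  have hM : (Matrix.toEuclideanLin (driftMat a b A H) (errVec x x0 d (d + k))) (i, c)
      = b * ∑ j, A i j * (x k i c - x0 c - (x k j c - x0 c))
        + a * ((H i)ᵀ *ᵥ (H i *ᵥ fun c => x k i c - x0 c)) c := by
    rw [Matrix.toLpLin_apply]
    simp only [driftMat, Matrix.add_mulVec, Matrix.smul_mulVec, Pi.add_apply, Pi.smul_apply,
      smul_eq_mul, lapl_kronecker_mulVec_apply, blockHtH_mulVec_apply, errVec, ht]
  have hsub : (fun c => x k i c - x0 c) = x k i - x0 := rfl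
  have hH : (H i *ᵥ x0 + v i) - H i *ᵥ x k i = v i - H i *ᵥ (x k i - x0) := by
    rw [Matrix.mulVec_sub]; abel
  have hv : ∑ r, H i r c * v i r = ((H i)ᵀ *ᵥ v i) c := by
    simp [Matrix.mulVec, dotProduct]
  have h1 : (errVec x x0 d (d + k + 1)) (i, c) = x (k + 1) i c - x0 c := by
    simp only [errVec, ht1]
  have h2 : (errVec x x0 d (d + k)) (i, c) = x k i c - x0 c := by
    simp only [errVec, ht]
  have h3 : (delayVec b A lam (errVec x x0 d) (d + k)) (i, c)
      = b * ∑ j, A i j * (x (k - lam j i) j c - x0 c - (x k j c - x0 c)) := by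
    simp only [delayVec, errVec, ht, htl]
  have h4 : (noiseVec a H v) (i, c) = a * ((H i)ᵀ *ᵥ v i) c := by
    simp only [noiseVec, hv]
  simp only [PiLp.add_apply, PiLp.sub_apply]
  rw [h1, h2, h3, h4, hM, hrec i, hsub, hH, Matrix.mulVec_sub]
  simp only [Pi.sub_apply]
  have hs : ∑ j, A i j * (x (k - lam j i) j c - x k i c)
      = ∑ j, A i j * (x (k - lam j i) j c - x0 c - (x k j c - x0 c))
        - ∑ j, A i j * (x k i c - x0 c - (x k j c - x0 c)) := by
    rw [← Finset.sum_sub_distrib]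
    exact Finset.sum_congr rfl fun j _ => by ring
  rw [hs]
  ring

theorem abs_lapl_kronecker_le {A : Matrix (Fin N) (Fin N) ℝ} {βa : ℝ} (hA : ∀ i j, |A i j| ≤ βa)
    (p q : Fin N × Fin n) :
    |(lapl A ⊗ₖ (1 : Matrix (Fin n) (Fin n) ℝ)) p q| ≤ (N + 1) * βa := by
  have hβ : 0 ≤ βa := (abs_nonneg _).trans (hA p.1 p.1)
  have h1 : |lapl A p.1 q.1| ≤ (N + 1) * βa := by
    rw [lapl, Matrix.sub_apply, add_mul, one_mul]
    refine (abs_sub _ _).trans (add_le_add ?_ (hA _ _))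
    rw [degMat, Matrix.diagonal_apply]
    split_ifs
    · refine (Finset.abs_sum_le_sum_abs _ _).trans ((Finset.sum_le_sum fun j _ => hA _ j).trans ?_)
      simp
    · simp; positivity
  rw [Matrix.kroneckerMap_apply, abs_mul, Matrix.one_apply]
  split_ifs
  · simpa using h1
  · simp; positivity

theorem abs_blockHtH_le {H : ∀ i : Fin N, Matrix (Fin (ni i)) (Fin n) ℝ} {βH : ℝ}
    (hni : ∀ i, ni i ≤ n) (hH : ∀ i r c, |H i r c| ≤ βH) (p q : Fin N × Fin n) :
    |blockHtH H p q| ≤ n * βH ^ 2 := by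
  rw [blockHtH, Matrix.of_apply]
  split_ifs
  · rw [Matrix.mul_apply]
    refine (Finset.abs_sum_le_sum_abs _ _).trans ?_
    refine (Finset.sum_le_sum (g := fun _ => βH ^ 2) fun r _ => ?_).trans ?_
    · rw [abs_mul, sq, Matrix.transpose_apply]
      exact mul_le_mul (hH _ _ _) (hH _ _ _) (abs_nonneg _) ((abs_nonneg _).trans (hH p.1 r p.2))
    · simp only [Finset.sum_const, Finset.card_univ, Fintype.card_fin, nsmul_eq_mul]
      exact mul_le_mul_of_nonneg_right (by exact_mod_cast hni p.1) (sq_nonneg _)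
  · simp; positivity

theorem norm_delayVec_sq_le {b βa : ℝ} {A : Matrix (Fin N) (Fin N) ℝ}
    (hA : ∀ i j, |A i j| ≤ βa) {lam : Fin N → Fin N → ℕ} {d t : ℕ} (hlam : ∀ j i, lam j i ≤ d)
    (ht : d ≤ t) (y : ℕ → EuclideanSpace ℝ (Fin N × Fin n)) :
    ‖delayVec b A lam y t‖ ^ 2 ≤ b ^ 2 * (N * n * N * βa ^ 2 * (N * 4 ^ d)) *
      incrementEnergy y t := by
  have hdiff : ∀ (i j : Fin N) (c : Fin n),
      (y (t - lam j i) (j, c) - y t (j, c)) ^ 2 ≤ 4 ^ d * incrementEnergy y t := by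
    intro i j c
    have h1 := hlam j i
    have h2 := norm_sub_sq_le_incrementEnergy_add y (t - lam j i) (lam j i)
    rw [Nat.sub_add_cancel (h1.trans ht)] at h2
    have h3 := PiLp.norm_apply_le (y t - y (t - lam j i)) (j, c)
    have h4 : (y (t - lam j i) (j, c) - y t (j, c)) ^ 2 ≤ ‖y t - y (t - lam j i)‖ ^ 2 := by
      rw [PiLp.sub_apply, Real.norm_eq_abs] at h3
      rw [← sq_abs, abs_sub_comm]
      exact pow_le_pow_left₀ (abs_nonneg _) h3 2
    refine h4.trans (h2.trans ?_)
    exact mul_le_mul_of_nonneg_right (pow_le_pow_right₀ (by norm_num) h1)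
      (incrementEnergy_nonneg y t)
  rw [EuclideanSpace.real_norm_sq_eq]
  have hcoord : ∀ p ∈ (Finset.univ : Finset (Fin N × Fin n)), (delayVec b A lam y t p) ^ 2
      ≤ b ^ 2 * (N * βa ^ 2 * (N * (4 ^ d * incrementEnergy y t))) := by
    intro p _
    simp only [delayVec]
    rw [mul_pow]
    refine mul_le_mul_of_nonneg_left ?_ (sq_nonneg b)
    refine (Finset.sum_mul_sq_le_sq_mul_sq _ _ _).trans ?_
    refine mul_le_mul ?_ ?_ (Finset.sum_nonneg fun j _ => sq_nonneg _) (by positivity)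
    · refine (Finset.sum_le_sum (g := fun _ => βa ^ 2) fun j _ => ?_).trans (by simp)
      rw [← sq_abs]
      exact pow_le_pow_left₀ (abs_nonneg _) (hA _ _) 2
    · exact (Finset.sum_le_sum fun j _ => hdiff p.1 j p.2).trans (by simp)
  refine (Finset.sum_le_sum hcoord).trans (le_of_eq ?_)
  simp
  ring

theorem norm_noiseVec_sq_le {a βH : ℝ} {H : ∀ i : Fin N, Matrix (Fin (ni i)) (Fin n) ℝ}
    (hni : ∀ i, ni i ≤ n) (hH : ∀ i r c, |H i r c| ≤ βH) (v : ∀ i : Fin N, Fin (ni i) → ℝ) :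
    ‖noiseVec a H v‖ ^ 2 ≤ a ^ 2 * (n * (n * βH ^ 2)) * ∑ i, ∑ r, v i r ^ 2 := by
  rw [EuclideanSpace.real_norm_sq_eq, Fintype.sum_prod_type, Finset.mul_sum]
  refine Finset.sum_le_sum fun i _ => ?_
  have hcoord : ∀ c ∈ (Finset.univ : Finset (Fin n)), (noiseVec a H v (i, c)) ^ 2
      ≤ a ^ 2 * ((n * βH ^ 2) * ∑ r, v i r ^ 2) := by
    intro c _
    simp only [noiseVec]
    rw [mul_pow]
    refine mul_le_mul_of_nonneg_left ?_ (sq_nonneg a)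
    refine (Finset.sum_mul_sq_le_sq_mul_sq _ _ _).trans ?_
    refine mul_le_mul_of_nonneg_right ?_ (Finset.sum_nonneg fun r _ => sq_nonneg _)
    refine (Finset.sum_le_sum (g := fun _ => βH ^ 2) fun r _ => ?_).trans ?_
    · rw [← sq_abs]
      exact pow_le_pow_left₀ (abs_nonneg _) (hH _ _ _) 2
    · simp only [Finset.sum_const, Finset.card_univ, Fintype.card_fin, nsmul_eq_mul]
      exact mul_le_mul_of_nonneg_right (by exact_mod_cast hni i) (sq_nonneg _)
  refine (Finset.sum_le_sum hcoord).trans (le_of_eq ?_)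
  simp
  ring

end Model

section Pathwise

variable {N n : ℕ} {ni : Fin N → ℕ}

/-- The information matrix `r ℒ̂ ⊗ I + ℋᵀℋ`. -/
noncomputable def infoMat (r : ℝ) (A : Matrix (Fin N) (Fin N) ℝ)
    (H : ∀ i : Fin N, Matrix (Fin (ni i)) (Fin n) ℝ) :
    Matrix (Fin N × Fin n) (Fin N × Fin n) ℝ :=
  r • (symmLapl A ⊗ₖ (1 : Matrix (Fin n) (Fin n) ℝ)) + blockHtH H

theorem dotProduct_symmLapl_kronecker (A : Matrix (Fin N) (Fin N) ℝ) (z : Fin N × Fin n → ℝ) :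
    z ⬝ᵥ (symmLapl A ⊗ₖ (1 : Matrix (Fin n) (Fin n) ℝ)) *ᵥ z
      = z ⬝ᵥ (lapl A ⊗ₖ (1 : Matrix (Fin n) (Fin n) ℝ)) *ᵥ z := by
  have h1 : symmLapl A ⊗ₖ (1 : Matrix (Fin n) (Fin n) ℝ)
      = (2 : ℝ)⁻¹ • (lapl A ⊗ₖ (1 : Matrix (Fin n) (Fin n) ℝ)
        + (lapl A ⊗ₖ (1 : Matrix (Fin n) (Fin n) ℝ))ᵀ) := by
    rw [symmLapl, Matrix.smul_kronecker, Matrix.add_kronecker, ← Matrix.kroneckerMap_transpose,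
      Matrix.transpose_one]
  have h2 : z ⬝ᵥ (lapl A ⊗ₖ (1 : Matrix (Fin n) (Fin n) ℝ))ᵀ *ᵥ z
      = z ⬝ᵥ (lapl A ⊗ₖ (1 : Matrix (Fin n) (Fin n) ℝ)) *ᵥ z := by
    rw [Matrix.mulVec_transpose, dotProduct_comm, Matrix.dotProduct_mulVec]
  rw [h1, Matrix.smul_mulVec, Matrix.add_mulVec, dotProduct_smul, dotProduct_add, h2, smul_eq_mul]
  ring

theorem inner_driftMat {a b : ℝ} (ha : a ≠ 0) (A : Matrix (Fin N) (Fin N) ℝ)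
    (H : ∀ i : Fin N, Matrix (Fin (ni i)) (Fin n) ℝ) (z : EuclideanSpace ℝ (Fin N × Fin n)) :
    inner ℝ z (Matrix.toEuclideanLin (driftMat a b A H) z)
      = a * (z.ofLp ⬝ᵥ infoMat (b / a) A H *ᵥ z.ofLp) := by
  rw [Matrix.toLpLin_apply, EuclideanSpace.inner_eq_star_dotProduct, star_trivial,
    dotProduct_comm, driftMat, infoMat]
  simp only [Matrix.add_mulVec, Matrix.smul_mulVec, dotProduct_add, dotProduct_smul,
    dotProduct_symmLapl_kronecker, smul_eq_mul]
  field_simp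

/-- A constant `c` such that a step with consensus gain `b` is a delay step of size `c b`. -/
noncomputable def stepConst (N n d : ℕ) (βa βH Ca : ℝ) : ℝ :=
  N * n * ((N + 1) * βa + Ca * (n * βH ^ 2)) + (N * n * N * βa ^ 2 * (N * 4 ^ d) + 1)

theorem stepConst_nonneg {N n d : ℕ} {βa βH Ca : ℝ} (hβa : 0 ≤ βa) (hCa : 0 ≤ Ca) :
    0 ≤ stepConst N n d βa βH Ca := by
  unfold stepConst; positivity

theorem norm_driftMat_le {d : ℕ} {a b βa βH Ca : ℝ} {A : Matrix (Fin N) (Fin N) ℝ}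
    {H : ∀ i : Fin N, Matrix (Fin (ni i)) (Fin n) ℝ} (hni : ∀ i, ni i ≤ n)
    (hβa : 0 ≤ βa) (hA : ∀ i j, |A i j| ≤ βa) (hH : ∀ i r c, |H i r c| ≤ βH) (hCa : 0 ≤ Ca)
    (ha : 0 ≤ a) (hb : 0 ≤ b) (hab : a ≤ Ca * b) (z : EuclideanSpace ℝ (Fin N × Fin n)) :
    ‖Matrix.toEuclideanLin (driftMat a b A H) z‖ ≤ stepConst N n d βa βH Ca * b * ‖z‖ := by
  have hM : ∀ p q, |driftMat a b A H p q| ≤ b * ((N + 1) * βa + Ca * (n * βH ^ 2)) := by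
    intro p q
    rw [driftMat, Matrix.add_apply, Matrix.smul_apply, Matrix.smul_apply, smul_eq_mul, smul_eq_mul]
    refine (abs_add_le _ _).trans ?_
    rw [abs_mul, abs_mul, abs_of_nonneg ha, abs_of_nonneg hb, mul_add]
    refine add_le_add (mul_le_mul_of_nonneg_left (abs_lapl_kronecker_le hA p q) hb) ?_
    calc a * |blockHtH H p q| ≤ (Ca * b) * (n * βH ^ 2) :=
          mul_le_mul hab (abs_blockHtH_le hni hH p q) (abs_nonneg _) (by positivity)
      _ = b * (Ca * (n * βH ^ 2)) := by ring
  refine (norm_toEuclideanLin_le _ (by positivity) hM z).trans ?_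
  refine mul_le_mul_of_nonneg_right ?_ (norm_nonneg _)
  have h0 : 0 ≤ N * n * N * βa ^ 2 * ((N : ℝ) * 4 ^ d) + 1 := by positivity
  rw [stepConst, Fintype.card_prod, Fintype.card_fin, Fintype.card_fin, Nat.cast_mul]
  nlinarith [mul_nonneg h0 hb]

theorem norm_delayVec_sq_le_stepConst {d t : ℕ} {b βa βH Ca : ℝ} {A : Matrix (Fin N) (Fin N) ℝ}
    {lam : Fin N → Fin N → ℕ} (hβa : 0 ≤ βa) (hA : ∀ i j, |A i j| ≤ βa) (hCa : 0 ≤ Ca)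
    (hlam : ∀ j i, lam j i ≤ d) (ht : d ≤ t) (y : ℕ → EuclideanSpace ℝ (Fin N × Fin n)) :
    ‖delayVec b A lam y t‖ ^ 2
      ≤ (stepConst N n d βa βH Ca * b) ^ 2 * incrementEnergy y t := by
  refine (norm_delayVec_sq_le hA hlam ht y).trans
    (mul_le_mul_of_nonneg_right ?_ (incrementEnergy_nonneg y t))
  rw [mul_pow, mul_comm]
  refine mul_le_mul_of_nonneg_right ?_ (sq_nonneg b)
  have h0 : 0 ≤ N * n * N * βa ^ 2 * ((N : ℝ) * 4 ^ d) := by positivity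
  have h1 : 0 ≤ N * n * ((N + 1) * βa + Ca * (n * βH ^ 2)) := by positivity
  rw [stepConst]
  nlinarith [mul_nonneg h0 h1, mul_nonneg h0 h0, mul_nonneg h1 h1]

/-- Replacing the gain `a` by a smaller gain `a'` in the drift costs at most a multiple of the
decrease of the gain. -/
theorem inner_driftMat_ge {d : ℕ} {a b a' a₀ b₀ βa βH Ca : ℝ} {A : Matrix (Fin N) (Fin N) ℝ}
    {H : ∀ i : Fin N, Matrix (Fin (ni i)) (Fin n) ℝ} (hni : ∀ i, ni i ≤ n)
    (hβa : 0 ≤ βa) (hA : ∀ i j, |A i j| ≤ βa) (hH : ∀ i r c, |H i r c| ≤ βH) (hCa : 0 ≤ Ca)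
    (hb : 0 ≤ b) (hab : a ≤ Ca * b) (ha' : 0 < a') (ha'a : a' ≤ a) (haa₀ : a ≤ a₀) (hbb₀ : b ≤ b₀)
    (z : EuclideanSpace ℝ (Fin N × Fin n)) :
    a' * (z.ofLp ⬝ᵥ infoMat (b / a) A H *ᵥ z.ofLp)
        - stepConst N n d βa βH Ca * ((a₀ - a') * (b₀ / a')) * ‖z‖ ^ 2
      ≤ inner ℝ z (Matrix.toEuclideanLin (driftMat a b A H) z) := by
  have ha : 0 < a := ha'.trans_le ha'a
  have hc := stepConst_nonneg (N := N) (n := n) (d := d) (βH := βH) hβa hCa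
  have hi := inner_driftMat (b := b) ha.ne' A H z
  have hn := norm_driftMat_le (d := d) hni hβa hA hH hCa ha.le hb hab z
  set q := z.ofLp ⬝ᵥ infoMat (b / a) A H *ᵥ z.ofLp
  set c := stepConst N n d βa βH Ca
  have h1 : -(c * b * ‖z‖ ^ 2) ≤ a * q := by
    rw [← hi]
    have h2 := abs_real_inner_le_norm z (Matrix.toEuclideanLin (driftMat a b A H) z)
    have h3 := mul_le_mul_of_nonneg_left hn (norm_nonneg z)
    linarith [neg_abs_le (inner ℝ z (Matrix.toEuclideanLin (driftMat a b A H) z))]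
  rw [hi]
  have h4 : -(c * (b / a) * ‖z‖ ^ 2) ≤ q := by
    have : -(c * (b / a) * ‖z‖ ^ 2) = -(c * b * ‖z‖ ^ 2) / a := by field_simp
    rw [this, div_le_iff₀ ha]; linarith
  have h5 : (a - a') * (b / a) ≤ (a₀ - a') * (b₀ / a') := by
    refine mul_le_mul (by linarith) ?_ (by positivity) (by linarith)
    exact div_le_div₀ (hb.trans hbb₀) hbb₀ ha' ha'a
  have h6 := mul_le_mul_of_nonneg_left h4 (sub_nonneg.2 ha'a)
  have h7 := mul_le_mul_of_nonneg_left h5 (mul_nonneg hc (sq_nonneg ‖z‖))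
  nlinarith

end Pathwise

section Measurability

variable {Ω : Type*} {N n : ℕ} {ni : Fin N → ℕ}
  {H : ℕ → ∀ i : Fin N, Ω → Matrix (Fin (ni i)) (Fin n) ℝ}
  {v : ℕ → Ω → ∀ i : Fin N, Fin (ni i) → ℝ}
  {A : ℕ → Ω → Matrix (Fin N) (Fin N) ℝ}
  {lam : ℕ → Fin N → Fin N → Ω → ℕ}

/-- All the data strictly before time `k` are measurable with respect to `m`. -/
structure DataMeasurable (H : ℕ → ∀ i : Fin N, Ω → Matrix (Fin (ni i)) (Fin n) ℝ)
    (v : ℕ → Ω → ∀ i : Fin N, Fin (ni i) → ℝ) (A : ℕ → Ω → Matrix (Fin N) (Fin N) ℝ)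
    (lam : ℕ → Fin N → Fin N → Ω → ℕ) (k : ℕ) (m : MeasurableSpace Ω) : Prop where
  obs : ∀ s < k, Measurable[m] fun ω (i : Fin N) (p : Fin (ni i)) (c : Fin n) => H s i ω p c
  noise : ∀ s < k, Measurable[m] (v s)
  adj : ∀ s < k, Measurable[m] fun ω (i j : Fin N) => A s ω i j
  delay : ∀ s < k, Measurable[m] fun ω (j i : Fin N) => lam s j i ω

theorem dataMeasurable_iff {k : ℕ} {m : MeasurableSpace Ω} :
    DataMeasurable H v A lam k m ↔ sigBeforeD H v A lam k ≤ m := by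
  simp only [sigBeforeD, iSup_le_iff, sup_le_iff, ← measurable_iff_comap_le]
  exact ⟨fun h s hs => ⟨⟨⟨h.obs s hs, h.noise s hs⟩, h.adj s hs⟩, h.delay s hs⟩,
    fun h => ⟨fun s hs => (h s hs).1.1.1, fun s hs => (h s hs).1.1.2,
      fun s hs => (h s hs).1.2, fun s hs => (h s hs).2⟩⟩

/-- The estimates at time `k` are measurable functions of the data before time `k`. -/
theorem DataMeasurable.estimate {k d : ℕ} {m : MeasurableSpace Ω}
    (hm : DataMeasurable H v A lam k m) {x0 : Fin n → ℝ} {a b : ℕ → ℝ}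
    {x : ℤ → Fin N → Ω → Fin n → ℝ} (hlam : ∀ k j i ω, lam k j i ω ≤ d)
    (hxinit : ∀ s : ℤ, -(d:ℤ) ≤ s → s ≤ 0 → ∀ i, ∃ c : Fin n → ℝ, ∀ ω, x s i ω = c)
    (hrec : ∀ (k : ℕ) (i : Fin N) (ω : Ω), x ((k:ℤ)+1) i ω = fun p =>
      x (k:ℤ) i ω p
        + a k * ((H k i ω)ᵀ.mulVec
            (((H k i ω).mulVec x0 + v k ω i) - (H k i ω).mulVec (x (k:ℤ) i ω))) p
        + b k * ∑ j, A k ω i j * (x ((k:ℤ) - (lam k j i ω : ℤ)) j ω p - x (k:ℤ) i ω p)) :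
    ∀ s : ℤ, -(d:ℤ) ≤ s → s ≤ k → ∀ i p, Measurable[m] fun ω => x s i ω p := by
  induction k with
  | zero =>
    intro s hs hs0 i p
    obtain ⟨c, hc⟩ := hxinit s hs (by simpa using hs0) i
    simp only [hc]
    exact measurable_const
  | succ k ih =>
    have ih := ih ⟨fun s hs => hm.obs s (by omega), fun s hs => hm.noise s (by omega),
      fun s hs => hm.adj s (by omega), fun s hs => hm.delay s (by omega)⟩
    intro s hs hsk i p
    rcases eq_or_lt_of_le hsk with rfl | hlt
    swap
    · exact ih s hs (by push_cast at hlt; omega) i p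
    have hH : ∀ r c, Measurable[m] fun ω => H k i ω r c := fun r c =>
      (measurable_pi_apply c).comp ((measurable_pi_apply r).comp
        ((measurable_pi_apply i).comp (hm.obs k (by omega))))
    have hv : ∀ r, Measurable[m] fun ω => v k ω i r := fun r =>
      (measurable_pi_apply r).comp ((measurable_pi_apply i).comp (hm.noise k (by omega)))
    have hA : ∀ j, Measurable[m] fun ω => A k ω i j := fun j =>
      (measurable_pi_apply j).comp ((measurable_pi_apply i).comp (hm.adj k (by omega)))
    have hl : ∀ j, Measurable[m] fun ω => lam k j i ω := fun j =>
      (measurable_pi_apply i).comp ((measurable_pi_apply j).comp (hm.delay k (by omega)))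
    have hx : ∀ c, Measurable[m] fun ω => x (k : ℤ) i ω c := fun c =>
      ih k (by omega) le_rfl i c
    have hxl : ∀ j, Measurable[m] fun ω => x ((k:ℤ) - (lam k j i ω : ℤ)) j ω p := by
      intro j
      have h1 : (fun ω => x ((k:ℤ) - (lam k j i ω : ℤ)) j ω p)
          = fun ω => ∑ q ∈ Finset.range (d + 1),
              if lam k j i ω = q then x ((k:ℤ) - (q : ℤ)) j ω p else 0 := by
        funext ω
        rw [Finset.sum_ite_eq, if_pos (Finset.mem_range.2 (Nat.lt_succ_of_le (hlam k j i ω)))]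
      rw [h1]
      refine Finset.measurable_fun_sum _ fun q hq => ?_
      have hq := Finset.mem_range.1 hq
      exact Measurable.ite (hl j (measurableSet_singleton q))
        (ih _ (by omega) (by omega) j p) measurable_const
    push_cast
    simp only [hrec, Matrix.mulVec, dotProduct, Pi.add_apply, Pi.sub_apply, Matrix.transpose_apply]
    refine ((hx p).add (measurable_const.mul ?_)).add (measurable_const.mul ?_)
    · refine Finset.measurable_fun_sum _ fun r _ => (hH r p).mul (Measurable.sub (Measurable.add ?_ (hv r)) ?_)
      · exact Finset.measurable_fun_sum _ fun c _ => (hH r c).mul measurable_const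
      · exact Finset.measurable_fun_sum _ fun c _ => (hH r c).mul (hx c)
    · exact Finset.measurable_fun_sum _ fun j _ => (hA j).mul ((hxl j).sub (hx p))

end Measurability

section Algorithm

variable {Ω : Type*} {N n : ℕ} {ni : Fin N → ℕ}

/-- The standing assumptions on the distributed estimation algorithm with random delays. -/
structure DelayedAlgorithm [MeasurableSpace Ω] (μ : Measure Ω) (d : ℕ)
    (H : ℕ → ∀ i : Fin N, Ω → Matrix (Fin (ni i)) (Fin n) ℝ)
    (v : ℕ → Ω → ∀ i : Fin N, Fin (ni i) → ℝ)
    (A : ℕ → Ω → Matrix (Fin N) (Fin N) ℝ)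
    (lam : ℕ → Fin N → Fin N → Ω → ℕ) (x0 : Fin n → ℝ) (a b : ℕ → ℝ)
    (x : ℤ → Fin N → Ω → Fin n → ℝ) (βv βa βH Ca : ℝ) : Prop where
  ni_le : ∀ i, ni i ≤ n
  data_measurable : ∀ k, DataMeasurable H v A lam k ‹MeasurableSpace Ω›
  delay_le : ∀ k j i ω, lam k j i ω ≤ d
  noise_sq_integrable : ∀ k, Integrable (fun ω => ∑ i, ∑ p, (v k ω i p)^2) μ
  initial : ∀ s : ℤ, -(d:ℤ) ≤ s → s ≤ 0 → ∀ i, ∃ c : Fin n → ℝ, ∀ ω, x s i ω = c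
  recursion : ∀ (k : ℕ) (i : Fin N) (ω : Ω), x ((k:ℤ)+1) i ω = fun p =>
      x (k:ℤ) i ω p
        + a k * ((H k i ω)ᵀ.mulVec
            (((H k i ω).mulVec x0 + v k ω i) - (H k i ω).mulVec (x (k:ℤ) i ω))) p
        + b k * ∑ j, A k ω i j * (x ((k:ℤ) - (lam k j i ω : ℤ)) j ω p - x (k:ℤ) i ω p)
  noise_indep : ProbabilityTheory.IndepFun
      (fun ω => fun k => v k ω)
      (fun ω => fun k =>
        ((fun (i : Fin N) (p : Fin (ni i)) (c : Fin n) => H k i ω p c),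
         (fun (i j : Fin N) => A k ω i j),
         (fun (j i : Fin N) => lam k j i ω))) μ
  noise_mean : ∀ k i p, (μ[(fun ω => v k ω i p)|sigBeforeD H v A lam k]) =ᵐ[μ] 0
  noise_var : ∀ k, ∀ᵐ ω ∂μ,
      (μ[(fun ω' => ∑ i, ∑ p, (v k ω' i p)^2)|sigBeforeD H v A lam k]) ω ≤ βv
  adj_bound_nonneg : 0 ≤ βa
  adj_bound : ∀ᵐ ω ∂μ, ∀ k i j, |A k ω i j| ≤ βa
  obs_bound : ∀ᵐ ω ∂μ, ∀ k i r c, |H k i ω r c| ≤ βH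
  a_pos : ∀ k, 0 < a k
  b_pos : ∀ k, 0 < b k
  a_anti : Antitone a
  b_anti : Antitone b
  gain_const_nonneg : 0 ≤ Ca
  a_le : ∀ k, a k ≤ Ca * b k

/-- The trajectory of the stacked estimation error along the sample point `ω`. -/
noncomputable def errPath (x : ℤ → Fin N → Ω → Fin n → ℝ) (x0 : Fin n → ℝ) (d : ℕ) (ω : Ω)
    (t : ℕ) : EuclideanSpace ℝ (Fin N × Fin n) :=
  errVec (fun s i => x s i ω) x0 d t

/-- The trajectory of the stacked noise along `ω`, shifted in time by `d`. -/
noncomputable def noisePath (H : ℕ → ∀ i : Fin N, Ω → Matrix (Fin (ni i)) (Fin n) ℝ)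
    (v : ℕ → Ω → ∀ i : Fin N, Fin (ni i) → ℝ) (a : ℕ → ℝ) (d : ℕ) (ω : Ω) (t : ℕ) :
    EuclideanSpace ℝ (Fin N × Fin n) :=
  noiseVec (a (t - d)) (fun i => H (t - d) i ω) (v (t - d) ω)

/-- The trajectory of the drift along `ω`, shifted in time by `d`. -/
noncomputable def driftPath (H : ℕ → ∀ i : Fin N, Ω → Matrix (Fin (ni i)) (Fin n) ℝ)
    (A : ℕ → Ω → Matrix (Fin N) (Fin N) ℝ) (a b : ℕ → ℝ) (d : ℕ) (ω : Ω) (t : ℕ) :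
    EuclideanSpace ℝ (Fin N × Fin n) →ₗ[ℝ] EuclideanSpace ℝ (Fin N × Fin n) :=
  Matrix.toEuclideanLin (driftMat (a (t - d)) (b (t - d)) (A (t - d) ω) fun i => H (t - d) i ω)

/-- The trajectory of the delay perturbation along `ω`, shifted in time by `d`. -/
noncomputable def delayPath (A : ℕ → Ω → Matrix (Fin N) (Fin N) ℝ)
    (lam : ℕ → Fin N → Fin N → Ω → ℕ) (b : ℕ → ℝ) (x : ℤ → Fin N → Ω → Fin n → ℝ)
    (x0 : Fin n → ℝ) (d : ℕ) (ω : Ω) (t : ℕ) : EuclideanSpace ℝ (Fin N × Fin n) :=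
  delayVec (b (t - d)) (A (t - d) ω) (fun j i => lam (t - d) j i ω) (errPath x x0 d ω) t

namespace DelayedAlgorithm

variable [m0 : MeasurableSpace Ω] {μ : Measure Ω} {d : ℕ}
  {H : ℕ → ∀ i : Fin N, Ω → Matrix (Fin (ni i)) (Fin n) ℝ}
  {v : ℕ → Ω → ∀ i : Fin N, Fin (ni i) → ℝ}
  {A : ℕ → Ω → Matrix (Fin N) (Fin N) ℝ}
  {lam : ℕ → Fin N → Fin N → Ω → ℕ} {x0 : Fin n → ℝ} {a b : ℕ → ℝ}
  {x : ℤ → Fin N → Ω → Fin n → ℝ} {βv βa βH Ca : ℝ}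

theorem ae_delayStep (S : DelayedAlgorithm μ d H v A lam x0 a b x βv βa βH Ca) :
    ∀ᵐ ω ∂μ, ∀ k₀ k, k₀ ≤ k → DelayStep (errPath x x0 d ω) (delayPath A lam b x x0 d ω)
      (noisePath H v a d ω) (driftPath H A a b d ω) (stepConst N n d βa βH Ca * b k₀) (d + k) := by
  filter_upwards [S.adj_bound, S.obs_bound] with ω hA hH k₀ k hk
  have hc := stepConst_nonneg (N := N) (n := n) (d := d) (βH := βH)
    S.adj_bound_nonneg S.gain_const_nonneg
  have hle : stepConst N n d βa βH Ca * b k ≤ stepConst N n d βa βH Ca * b k₀ :=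
    mul_le_mul_of_nonneg_left (S.b_anti hk) hc
  have hdk : d + k - d = k := by omega
  refine ⟨?_, fun z => ?_, ?_⟩
  · simp only [errPath, driftPath, delayPath, noisePath, hdk]
    exact errVec_succ (fun j i => S.delay_le k j i ω) (fun i => S.recursion k i ω)
  · simp only [driftPath, hdk]
    exact (norm_driftMat_le S.ni_le S.adj_bound_nonneg (hA k) (hH k) S.gain_const_nonneg
      (S.a_pos k).le (S.b_pos k).le (S.a_le k) z).trans
      (mul_le_mul_of_nonneg_right hle (norm_nonneg z))
  · simp only [delayPath, hdk]
    exact (norm_delayVec_sq_le_stepConst S.adj_bound_nonneg (hA k) S.gain_const_nonneg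
      (fun j i => S.delay_le k j i ω) (Nat.le_add_right d k) _).trans
      (mul_le_mul_of_nonneg_right (pow_le_pow_left₀ (mul_nonneg hc (S.b_pos k).le) hle 2)
        (incrementEnergy_nonneg _ _))

theorem measurable_errPath_apply (S : DelayedAlgorithm μ d H v A lam x0 a b x βv βa βH Ca)
    {k t : ℕ} (ht : t ≤ d + k) (p : Fin N × Fin n) :
    ∀ m : MeasurableSpace Ω, DataMeasurable H v A lam k m →
      Measurable[m] fun ω => errPath x x0 d ω t p := by
  have hlam := S.delay_le
  have hinitial := S.initial
  have hrec := S.recursion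
  intro m hm
  exact (hm.estimate hlam hinitial hrec ((t : ℤ) - d) (by omega) (by omega) p.1 p.2).sub
    measurable_const

theorem measurable_errPath (S : DelayedAlgorithm μ d H v A lam x0 a b x βv βa βH Ca) (t : ℕ) :
    Measurable fun ω => errPath x x0 d ω t :=
  (WithLp.measurable_toLp 2 _).comp (measurable_pi_lambda _ fun p =>
    S.measurable_errPath_apply (Nat.le_add_left t d) p _ (S.data_measurable t))

theorem measurable_obs (S : DelayedAlgorithm μ d H v A lam x0 a b x βv βa βH Ca)
    (k : ℕ) (i : Fin N) (r : Fin (ni i)) (c : Fin n) : Measurable fun ω => H k i ω r c :=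
  (measurable_pi_apply c).comp ((measurable_pi_apply r).comp
    ((measurable_pi_apply i).comp ((S.data_measurable (k + 1)).obs k (Nat.lt_succ_self k))))

theorem measurable_noise (S : DelayedAlgorithm μ d H v A lam x0 a b x βv βa βH Ca)
    (k : ℕ) (i : Fin N) (r : Fin (ni i)) : Measurable fun ω => v k ω i r :=
  (measurable_pi_apply r).comp ((measurable_pi_apply i).comp
    ((S.data_measurable (k + 1)).noise k (Nat.lt_succ_self k)))

theorem measurable_adj (S : DelayedAlgorithm μ d H v A lam x0 a b x βv βa βH Ca)
    (k : ℕ) (i j : Fin N) : Measurable fun ω => A k ω i j :=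
  (measurable_pi_apply j).comp ((measurable_pi_apply i).comp
    ((S.data_measurable (k + 1)).adj k (Nat.lt_succ_self k)))

theorem measurable_noisePath (S : DelayedAlgorithm μ d H v A lam x0 a b x βv βa βH Ca) (t : ℕ) :
    Measurable fun ω => noisePath H v a d ω t :=
  (WithLp.measurable_toLp 2 _).comp (measurable_pi_lambda _ fun _ =>
    measurable_const.mul (Finset.measurable_fun_sum _ fun r _ =>
      (S.measurable_obs _ _ r _).mul (S.measurable_noise _ _ r)))

theorem measurable_delayEnergy (S : DelayedAlgorithm μ d H v A lam x0 a b x βv βa βH Ca) (t : ℕ) :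
    Measurable fun ω => delayEnergy (errPath x x0 d ω) t := by
  have h1 : Measurable fun ω => incrementEnergy (errPath x x0 d ω) t := by
    induction t with
    | zero => exact measurable_const
    | succ t ih =>
      exact (ih.div_const 2).add
        (((S.measurable_errPath (t + 1)).sub (S.measurable_errPath t)).norm.pow_const 2)
  exact ((S.measurable_errPath t).norm.pow_const 2).add h1

theorem ae_norm_noisePath_sq_le (S : DelayedAlgorithm μ d H v A lam x0 a b x βv βa βH Ca) :
    ∀ᵐ ω ∂μ, ∀ k, ‖noisePath H v a d ω (d + k)‖ ^ 2
      ≤ a k ^ 2 * (n * (n * βH ^ 2)) * ∑ i, ∑ r, v k ω i r ^ 2 := by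
  filter_upwards [S.obs_bound] with ω hH k
  simp only [noisePath, Nat.add_sub_cancel_left]
  exact norm_noiseVec_sq_le S.ni_le (hH k) _

theorem integrable_norm_noisePath_sq (S : DelayedAlgorithm μ d H v A lam x0 a b x βv βa βH Ca)
    (k : ℕ) : Integrable (fun ω => ‖noisePath H v a d ω (d + k)‖ ^ 2) μ := by
  refine ((S.noise_sq_integrable k).const_mul (a k ^ 2 * (n * (n * βH ^ 2)))).mono'
    ((S.measurable_noisePath _).norm.pow_const 2).aestronglyMeasurable ?_
  filter_upwards [S.ae_norm_noisePath_sq_le] with ω hω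
  rw [Real.norm_of_nonneg (sq_nonneg _)]
  exact hω k

theorem integral_norm_noisePath_sq_le [IsProbabilityMeasure μ]
    (S : DelayedAlgorithm μ d H v A lam x0 a b x βv βa βH Ca) (k : ℕ) :
    ∫ ω, ‖noisePath H v a d ω (d + k)‖ ^ 2 ∂μ ≤ n * (n * βH ^ 2) * βv * a k ^ 2 := by
  have h1 : ∫ ω, ∑ i, ∑ r, v k ω i r ^ 2 ∂μ ≤ βv := by
    rw [← integral_condExp (dataMeasurable_iff.1 (S.data_measurable k))]
    refine (integral_mono_ae integrable_condExp (integrable_const βv) (S.noise_var k)).trans ?_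
    simp
  calc ∫ ω, ‖noisePath H v a d ω (d + k)‖ ^ 2 ∂μ
      ≤ ∫ ω, a k ^ 2 * (n * (n * βH ^ 2)) * ∑ i, ∑ r, v k ω i r ^ 2 ∂μ :=
        integral_mono_ae (S.integrable_norm_noisePath_sq k)
          ((S.noise_sq_integrable k).const_mul _)
          (S.ae_norm_noisePath_sq_le.mono fun ω hω => hω k)
    _ = a k ^ 2 * (n * (n * βH ^ 2)) * ∫ ω, ∑ i, ∑ r, v k ω i r ^ 2 ∂μ := integral_const_mul _ _
    _ ≤ a k ^ 2 * (n * (n * βH ^ 2)) * βv := mul_le_mul_of_nonneg_left h1 (by positivity)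
    _ = _ := by ring

theorem integrable_delayEnergy [IsProbabilityMeasure μ]
    (S : DelayedAlgorithm μ d H v A lam x0 a b x βv βa βH Ca) (k : ℕ) :
    Integrable (fun ω => delayEnergy (errPath x x0 d ω) (d + k)) μ := by
  induction k with
  | zero =>
    have h1 : ∀ t ≤ d, ∀ ω ω', errPath x x0 d ω t = errPath x x0 d ω' t := by
      intro t ht ω ω'
      ext p
      obtain ⟨c, hc⟩ := S.initial ((t : ℤ) - d) (by omega) (by omega) p.1
      simp only [errPath, errVec, hc]
    have h2 : ∀ t ≤ d, ∀ ω ω', incrementEnergy (errPath x x0 d ω) t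
        = incrementEnergy (errPath x x0 d ω') t := by
      intro t
      induction t with
      | zero => intros; rfl
      | succ t ih =>
        intro ht ω ω'
        rw [incrementEnergy, incrementEnergy, ih (by omega) ω ω', h1 t (by omega) ω ω',
          h1 (t + 1) ht ω ω']
    rcases isEmpty_or_nonempty Ω with hΩ | ⟨⟨ω₀⟩⟩
    · exact (integrable_const (0 : ℝ)).congr (Eventually.of_forall fun ω => hΩ.elim ω)
    · refine (integrable_const (delayEnergy (errPath x x0 d ω₀) d)).congr
        (Eventually.of_forall fun ω => ?_)
      simp only [delayEnergy, add_zero, h1 d le_rfl ω ω₀, h2 d le_rfl ω ω₀]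
  | succ k ih =>
    have hc := stepConst_nonneg (N := N) (n := n) (d := d) (βH := βH)
      S.adj_bound_nonneg S.gain_const_nonneg
    refine ((ih.add (S.integrable_norm_noisePath_sq k)).const_mul
      (9 + 9 * (stepConst N n d βa βH Ca * b k) ^ 2)).mono'
      (S.measurable_delayEnergy _).aestronglyMeasurable ?_
    filter_upwards [S.ae_delayStep] with ω hω
    rw [Real.norm_of_nonneg (delayEnergy_nonneg _ _)]
    exact (hω k k le_rfl).delayEnergy_succ_le (mul_nonneg hc (S.b_pos k).le) le_rfl

theorem integrable_norm_errPath_sq [IsProbabilityMeasure μ]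
    (S : DelayedAlgorithm μ d H v A lam x0 a b x βv βa βH Ca) (k : ℕ) :
    Integrable (fun ω => ‖errPath x x0 d ω (d + k)‖ ^ 2) μ := by
  refine (S.integrable_delayEnergy k).mono'
    ((S.measurable_errPath _).norm.pow_const 2).aestronglyMeasurable
    (Eventually.of_forall fun ω => ?_)
  rw [Real.norm_of_nonneg (sq_nonneg _)]
  exact norm_sq_le_delayEnergy _ _

end DelayedAlgorithm

end Algorithm

section Expectations

variable {Ω : Type*} {N n : ℕ} {ni : Fin N → ℕ}

theorem sq_apply_le_sum_sum (u : ∀ i : Fin N, Fin (ni i) → ℝ) (i : Fin N) (r : Fin (ni i)) :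
    u i r ^ 2 ≤ ∑ i, ∑ r, u i r ^ 2 :=
  (Finset.single_le_sum (f := fun r => u i r ^ 2) (fun _ _ => sq_nonneg _)
    (Finset.mem_univ r)).trans
  (Finset.single_le_sum (f := fun i => ∑ r, u i r ^ 2)
    (fun _ _ => Finset.sum_nonneg fun _ _ => sq_nonneg _) (Finset.mem_univ i))

namespace DelayedAlgorithm

variable [m0 : MeasurableSpace Ω] {μ : Measure Ω} [IsProbabilityMeasure μ] {d : ℕ}
  {H : ℕ → ∀ i : Fin N, Ω → Matrix (Fin (ni i)) (Fin n) ℝ}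
  {v : ℕ → Ω → ∀ i : Fin N, Fin (ni i) → ℝ}
  {A : ℕ → Ω → Matrix (Fin N) (Fin N) ℝ}
  {lam : ℕ → Fin N → Fin N → Ω → ℕ} {x0 : Fin n → ℝ} {a b : ℕ → ℝ}
  {x : ℤ → Fin N → Ω → Fin n → ℝ} {βv βa βH Ca : ℝ}

theorem integrable_noise (S : DelayedAlgorithm μ d H v A lam x0 a b x βv βa βH Ca)
    (k : ℕ) (i : Fin N) (r : Fin (ni i)) : Integrable (fun ω => v k ω i r) μ := by
  refine ((integrable_const (1 : ℝ)).add (S.noise_sq_integrable k)).mono'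
    (S.measurable_noise k i r).aestronglyMeasurable (Eventually.of_forall fun ω => ?_)
  have h1 := sq_apply_le_sum_sum (v k ω) i r
  rw [Real.norm_eq_abs, Pi.add_apply]
  nlinarith [sq_nonneg (|v k ω i r| - 1), sq_abs (v k ω i r), abs_nonneg (v k ω i r)]

/-- The noise at time `k` stays centered given the noises before time `k` and the whole
process of observation matrices, graphs and delays. -/
theorem exists_condExp_noise_eq_zero (S : DelayedAlgorithm μ d H v A lam x0 a b x βv βa βH Ca)
    (k : ℕ) : ∃ m ≤ m0, DataMeasurable H v A lam k m ∧
      (∀ i r c, Measurable[m] fun ω => H k i ω r c) ∧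
      ∀ i r, μ[(fun ω => v k ω i r)|m] =ᵐ[μ] 0 := by
  set X : Ω → ℕ → ∀ i : Fin N, Fin (ni i) → ℝ := fun ω k => v k ω with hXdef
  set Z : Ω → ℕ → (∀ i : Fin N, Fin (ni i) → Fin n → ℝ) × (Fin N → Fin N → ℝ) ×
      (Fin N → Fin N → ℕ) := fun ω k =>
    ((fun i p c => H k i ω p c), (fun i j => A k ω i j), (fun j i => lam k j i ω)) with hZdef
  have hXm : Measurable X := measurable_pi_lambda _ fun k =>
    (S.data_measurable (k + 1)).noise k (Nat.lt_succ_self k)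
  have hZm : Measurable Z := measurable_pi_lambda _ fun k =>
    ((S.data_measurable (k + 1)).obs k (Nat.lt_succ_self k)).prodMk
      (((S.data_measurable (k + 1)).adj k (Nat.lt_succ_self k)).prodMk
        ((S.data_measurable (k + 1)).delay k (Nat.lt_succ_self k)))
  have hind : ProbabilityTheory.Indep (MeasurableSpace.comap X inferInstance)
      (MeasurableSpace.comap Z inferInstance) μ := S.noise_indep
  have hmean := S.noise_mean k
  have hint := S.integrable_noise k
  have hsig := dataMeasurable_iff.1 (S.data_measurable k)
  set mV : MeasurableSpace Ω := ⨆ s, ⨆ _ : s < k, MeasurableSpace.comap (v s) inferInstance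
    with hmV
  have hXv : ∀ s, Measurable[MeasurableSpace.comap X inferInstance] (v s) := fun s =>
    (measurable_pi_apply s).comp (comap_measurable X)
  have hVX : mV ≤ MeasurableSpace.comap X inferInstance :=
    iSup₂_le fun s _ => (hXv s).comap_le
  have hVsig : mV ≤ sigBeforeD H v A lam k :=
    iSup₂_le fun s hs => ((dataMeasurable_iff.2 le_rfl).noise s hs).comap_le
  have hZs : ∀ s, Measurable[MeasurableSpace.comap Z inferInstance] fun ω => Z ω s := fun s =>
    (measurable_pi_apply s).comp (comap_measurable Z)
  have hle : MeasurableSpace.comap Z inferInstance ≤ mV ⊔ MeasurableSpace.comap Z inferInstance :=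
    le_sup_right
  refine ⟨mV ⊔ MeasurableSpace.comap Z inferInstance, sup_le (hVX.trans hXm.comap_le) hZm.comap_le,
    ⟨fun s _ => ?_, fun s hs => ?_, fun s _ => ?_, fun s _ => ?_⟩, fun i r c => ?_, fun i r => ?_⟩
  · exact (measurable_fst.comp (hZs s)).mono hle le_rfl
  · refine measurable_iff_comap_le.2 (le_trans ?_ le_sup_left)
    exact le_iSup₂_of_le (f := fun s (_ : s < k) => MeasurableSpace.comap (v s) inferInstance)
      s hs le_rfl
  · exact ((measurable_fst.comp measurable_snd).comp (hZs s)).mono hle le_rfl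
  · exact ((measurable_snd.comp measurable_snd).comp (hZs s)).mono hle le_rfl
  · exact ((measurable_pi_apply c).comp ((measurable_pi_apply r).comp
      ((measurable_pi_apply i).comp (measurable_fst.comp (hZs k))))).mono hle le_rfl
  · refine condExp_sup_eq_zero_of_indep hXm.comap_le hVX hZm.comap_le hind ?_ (hint i r) ?_
    · exact ((measurable_pi_apply r).comp ((measurable_pi_apply i).comp
        (hXv k))).stronglyMeasurable
    · intro s hs
      rw [← setIntegral_condExp hsig (hint i r) (hVsig s hs),
        setIntegral_congr_ae (hsig s (hVsig s hs)) ((hmean i r).mono fun ω h _ => h)]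
      simp

theorem integrable_inner_noisePath (S : DelayedAlgorithm μ d H v A lam x0 a b x βv βa βH Ca)
    (k₀ k : ℕ) :
    Integrable (fun ω => inner ℝ (errPath x x0 d ω (d + k₀)) (noisePath H v a d ω (d + k))) μ := by
  refine ((S.integrable_norm_errPath_sq k₀).add (S.integrable_norm_noisePath_sq k)).mono'
    ((S.measurable_errPath _).inner (S.measurable_noisePath _)).aestronglyMeasurable
    (Eventually.of_forall fun ω => ?_)
  refine (norm_inner_le_norm _ _).trans ?_
  simp only [Pi.add_apply]
  nlinarith [sq_nonneg (‖errPath x x0 d ω (d + k₀)‖ - ‖noisePath H v a d ω (d + k)‖),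
    norm_nonneg (errPath x x0 d ω (d + k₀)), norm_nonneg (noisePath H v a d ω (d + k))]

theorem integral_inner_noisePath (S : DelayedAlgorithm μ d H v A lam x0 a b x βv βa βH Ca)
    {k₀ k : ℕ} (hk : k₀ ≤ k) :
    ∫ ω, inner ℝ (errPath x x0 d ω (d + k₀)) (noisePath H v a d ω (d + k)) ∂μ = 0 := by
  have hexp : ∀ ω, inner ℝ (errPath x x0 d ω (d + k₀)) (noisePath H v a d ω (d + k))
      = ∑ p : Fin N × Fin n, ∑ r : Fin (ni p.1),
        a k * ((errPath x x0 d ω (d + k₀) p * H k p.1 ω r p.2) * v k ω p.1 r) := by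
    intro ω
    rw [PiLp.inner_apply]
    refine Finset.sum_congr rfl fun p _ => ?_
    simp only [noisePath, noiseVec, Nat.add_sub_cancel_left, RCLike.inner_apply, conj_trivial,
      Finset.mul_sum, Finset.sum_mul]
    exact Finset.sum_congr rfl fun r _ => by ring
  have herr : ∀ p, ∀ m : MeasurableSpace Ω, DataMeasurable H v A lam k m →
      Measurable[m] fun ω => errPath x x0 d ω (d + k₀) p := fun p =>
    S.measurable_errPath_apply (by omega) p
  have hint : ∀ (p : Fin N × Fin n) (r : Fin (ni p.1)), Integrable
      (fun ω => (errPath x x0 d ω (d + k₀) p * H k p.1 ω r p.2) * v k ω p.1 r) μ := by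
    intro p r
    refine (((S.integrable_norm_errPath_sq k₀).add (S.noise_sq_integrable k)).const_mul βH).mono'
      (((herr p _ (S.data_measurable k)).mul (S.measurable_obs k p.1 r p.2)).mul
        (S.measurable_noise k p.1 r)).aestronglyMeasurable ?_
    filter_upwards [S.obs_bound] with ω hω
    have h1 := hω k p.1 r p.2
    have h2 := sq_apply_le_sum_sum (v k ω) p.1 r
    have h3 : |errPath x x0 d ω (d + k₀) p| ^ 2 ≤ ‖errPath x x0 d ω (d + k₀)‖ ^ 2 :=
      pow_le_pow_left₀ (abs_nonneg _) (PiLp.norm_apply_le (errPath x x0 d ω (d + k₀)) p) 2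
    rw [Real.norm_eq_abs, abs_mul, abs_mul, mul_comm |_| |H k p.1 ω r p.2|, mul_assoc,
      Pi.add_apply]
    refine mul_le_mul h1 ?_ (by positivity) ((abs_nonneg _).trans h1)
    nlinarith [sq_nonneg (|errPath x x0 d ω (d + k₀) p| - |v k ω p.1 r|), sq_abs (v k ω p.1 r),
      abs_nonneg (errPath x x0 d ω (d + k₀) p), abs_nonneg (v k ω p.1 r)]
  simp only [hexp]
  rw [integral_finsetSum _ fun p _ => integrable_finsetSum _ fun r _ => (hint p r).const_mul _]
  refine Finset.sum_eq_zero fun p _ => ?_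
  rw [integral_finsetSum _ fun r _ => (hint p r).const_mul _]
  refine Finset.sum_eq_zero fun r _ => ?_
  have hv := S.integrable_noise k p.1 r
  obtain ⟨m, hm, hdata, hobs, hzero⟩ := S.exists_condExp_noise_eq_zero k
  rw [integral_const_mul]
  exact mul_eq_zero_of_right _ (integral_mul_eq_zero_of_condExp_eq_zero hm
    ((herr p m hdata).mul (hobs p.1 r p.2)).stronglyMeasurable hv (hint p r) (hzero p.1 r))

end DelayedAlgorithm

end Expectations

section Excitation

variable {Ω : Type*} {N n : ℕ} {ni : Fin N → ℕ}

theorem abs_symmLapl_le {A : Matrix (Fin N) (Fin N) ℝ} {βa : ℝ} (hA : ∀ i j, |A i j| ≤ βa)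
    (i j : Fin N) : |symmLapl A i j| ≤ (N + 1) * βa := by
  have h1 : ∀ i j, |lapl A i j| ≤ (N + 1) * βa := fun i j => by
    simpa using abs_lapl_kronecker_le (n := 1) hA (i, 0) (j, 0)
  rw [symmLapl, Matrix.smul_apply, Matrix.add_apply, Matrix.transpose_apply, smul_eq_mul, abs_mul,
    abs_of_nonneg (by norm_num : (0 : ℝ) ≤ 2⁻¹)]
  linarith [abs_add_le (lapl A i j) (lapl A j i), h1 i j, h1 j i]

/-- Entrywise integrals determine the integral of a quadratic form. -/
theorem integral_quadForm_eq {ι : Type*} [Fintype ι] [MeasurableSpace Ω] {μ : Measure Ω}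
    {z : Ω → ι → ℝ} {M : Ω → Matrix ι ι ℝ}
    (hM : ∀ p q, Integrable (fun ω => z ω p * z ω q * M ω p q) μ) :
    Integrable (fun ω => z ω ⬝ᵥ M ω *ᵥ z ω) μ ∧
      ∫ ω, z ω ⬝ᵥ M ω *ᵥ z ω ∂μ = ∑ p, ∑ q, ∫ ω, z ω p * z ω q * M ω p q ∂μ := by
  have h1 : (fun ω => z ω ⬝ᵥ M ω *ᵥ z ω) = fun ω => ∑ p, ∑ q, z ω p * z ω q * M ω p q := by
    funext ω
    simp only [dotProduct, Matrix.mulVec, Finset.mul_sum]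
    exact Finset.sum_congr rfl fun p _ => Finset.sum_congr rfl fun q _ => by ring
  rw [h1]
  refine ⟨integrable_finsetSum _ fun p _ => integrable_finsetSum _ fun q _ => hM p q, ?_⟩
  rw [integral_finsetSum _ fun p _ => integrable_finsetSum _ fun q _ => hM p q]
  exact Finset.sum_congr rfl fun p _ => integral_finsetSum _ fun q _ => hM p q

namespace DelayedAlgorithm

variable [m0 : MeasurableSpace Ω] {μ : Measure Ω} [IsProbabilityMeasure μ] {d : ℕ}
  {H : ℕ → ∀ i : Fin N, Ω → Matrix (Fin (ni i)) (Fin n) ℝ}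
  {v : ℕ → Ω → ∀ i : Fin N, Fin (ni i) → ℝ}
  {A : ℕ → Ω → Matrix (Fin N) (Fin N) ℝ}
  {lam : ℕ → Fin N → Fin N → Ω → ℕ} {x0 : Fin n → ℝ} {a b : ℕ → ℝ}
  {x : ℤ → Fin N → Ω → Fin n → ℝ} {βv βa βH Ca : ℝ}

/-- Conditioning a bounded coefficient on the past does not change the expectation of its
product with two error coordinates. -/
theorem integral_errPath_mul_condExp (S : DelayedAlgorithm μ d H v A lam x0 a b x βv βa βH Ca)
    (k₀ : ℕ) (p q : Fin N × Fin n) {g : Ω → ℝ} (hg : Measurable g) {c : ℝ}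
    (hgc : ∀ᵐ ω ∂μ, |g ω| ≤ c) :
    Integrable (fun ω => errPath x x0 d ω (d + k₀) p * errPath x x0 d ω (d + k₀) q * g ω) μ ∧
    Integrable (fun ω => errPath x x0 d ω (d + k₀) p * errPath x x0 d ω (d + k₀) q *
      (μ[g|sigBeforeD H v A lam k₀]) ω) μ ∧
    ∫ ω, errPath x x0 d ω (d + k₀) p * errPath x x0 d ω (d + k₀) q *
      (μ[g|sigBeforeD H v A lam k₀]) ω ∂μ
      = ∫ ω, errPath x x0 d ω (d + k₀) p * errPath x x0 d ω (d + k₀) q * g ω ∂μ := by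
  have herr := fun p => S.measurable_errPath_apply (le_refl (d + k₀)) p
  have hle := dataMeasurable_iff.1 (S.data_measurable k₀)
  have hgi : Integrable g μ := (integrable_const c).mono' hg.aestronglyMeasurable hgc
  have hfg : Integrable
      (fun ω => errPath x x0 d ω (d + k₀) p * errPath x x0 d ω (d + k₀) q * g ω) μ := by
    refine ((S.integrable_norm_errPath_sq k₀).const_mul c).mono'
      (((herr p _ (S.data_measurable k₀)).mul
        (herr q _ (S.data_measurable k₀))).mul hg).aestronglyMeasurable ?_
    filter_upwards [hgc] with ω hω
    have h1 := PiLp.norm_apply_le (errPath x x0 d ω (d + k₀))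
    rw [norm_mul, norm_mul, Real.norm_eq_abs (g ω), mul_comm, sq]
    exact mul_le_mul hω (mul_le_mul (h1 p) (h1 q) (norm_nonneg _) (norm_nonneg _))
      (by positivity) ((abs_nonneg _).trans hω)
  have hf := ((herr p _ (dataMeasurable_iff.2 le_rfl)).mul
    (herr q _ (dataMeasurable_iff.2 le_rfl))).stronglyMeasurable
  exact ⟨hfg, integral_mul_condExp hle hf hgi hfg⟩

theorem integral_quadForm_infoMat (S : DelayedAlgorithm μ d H v A lam x0 a b x βv βa βH Ca)
    (k₀ k : ℕ) (r : ℝ) :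
    Integrable (fun ω => (errPath x x0 d ω (d + k₀)).ofLp ⬝ᵥ
      infoMat r (A k ω) (fun i => H k i ω) *ᵥ (errPath x x0 d ω (d + k₀)).ofLp) μ ∧
    Integrable (fun ω => (errPath x x0 d ω (d + k₀)).ofLp ⬝ᵥ
      (r • (cexpM μ (sigBeforeD H v A lam k₀) (fun ω' => symmLapl (A k ω')) ω
          ⊗ₖ (1 : Matrix (Fin n) (Fin n) ℝ))
        + cexpM μ (sigBeforeD H v A lam k₀) (fun ω' => blockHtH (fun i => H k i ω')) ω) *ᵥ
        (errPath x x0 d ω (d + k₀)).ofLp) μ ∧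
    ∫ ω, (errPath x x0 d ω (d + k₀)).ofLp ⬝ᵥ
      (r • (cexpM μ (sigBeforeD H v A lam k₀) (fun ω' => symmLapl (A k ω')) ω
          ⊗ₖ (1 : Matrix (Fin n) (Fin n) ℝ))
        + cexpM μ (sigBeforeD H v A lam k₀) (fun ω' => blockHtH (fun i => H k i ω')) ω) *ᵥ
        (errPath x x0 d ω (d + k₀)).ofLp ∂μ
      = ∫ ω, (errPath x x0 d ω (d + k₀)).ofLp ⬝ᵥ
        infoMat r (A k ω) (fun i => H k i ω) *ᵥ (errPath x x0 d ω (d + k₀)).ofLp ∂μ := by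
  have hL : ∀ i j, Measurable fun ω => symmLapl (A k ω) i j := by
    have h1 : ∀ i j, Measurable fun ω => lapl (A k ω) i j := by
      intro i j
      simp only [lapl, degMat, Matrix.sub_apply, Matrix.diagonal_apply]
      refine Measurable.sub ?_ (S.measurable_adj k i j)
      split_ifs
      · exact Finset.measurable_fun_sum _ fun j _ => S.measurable_adj k i j
      · exact measurable_const
    intro i j
    exact measurable_const.mul ((h1 i j).add (h1 j i))
  have hB : ∀ p q, Measurable fun ω => blockHtH (fun i => H k i ω) p q := by
    intro p q
    simp only [blockHtH, Matrix.of_apply]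
    split_ifs
    · simp only [Matrix.mul_apply, Matrix.transpose_apply]
      exact Finset.measurable_fun_sum _ fun r _ =>
        (S.measurable_obs k p.1 r p.2).mul (S.measurable_obs k p.1 r q.2)
    · exact measurable_const
  have eL := fun p q : Fin N × Fin n => S.integral_errPath_mul_condExp k₀ p q (hL p.1 q.1)
    (S.adj_bound.mono fun ω hω => abs_symmLapl_le (hω k) p.1 q.1)
  have eB := fun p q : Fin N × Fin n => S.integral_errPath_mul_condExp k₀ p q (hB p q)
    (S.obs_bound.mono fun ω hω => abs_blockHtH_le S.ni_le (hω k) p q)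
  have hentry : ∀ (z w : ℝ) (f g : ℝ) (e : ℝ),
      z * w * (r * (f * e) + g) = r * e * (z * w * f) + z * w * g := by intros; ring
  have hq₁ := integral_quadForm_eq (μ := μ) (z := fun ω => (errPath x x0 d ω (d + k₀)).ofLp)
    (M := fun ω => infoMat r (A k ω) (fun i => H k i ω)) (fun p q => by
      simp only [infoMat, Matrix.add_apply, Matrix.smul_apply, smul_eq_mul,
        Matrix.kroneckerMap_apply, hentry]
      exact ((eL p q).1.const_mul _).add (eB p q).1)
  have hq₂ := integral_quadForm_eq (μ := μ) (z := fun ω => (errPath x x0 d ω (d + k₀)).ofLp)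
    (M := fun ω => r • (cexpM μ (sigBeforeD H v A lam k₀) (fun ω' => symmLapl (A k ω')) ω
          ⊗ₖ (1 : Matrix (Fin n) (Fin n) ℝ))
        + cexpM μ (sigBeforeD H v A lam k₀) (fun ω' => blockHtH (fun i => H k i ω')) ω)
    (fun p q => by
      simp only [cexpM, Matrix.add_apply, Matrix.smul_apply, smul_eq_mul,
        Matrix.kroneckerMap_apply, Matrix.of_apply, hentry]
      exact ((eL p q).2.1.const_mul _).add (eB p q).2.1)
  refine ⟨hq₁.1, hq₂.1, hq₂.2.trans (Eq.trans ?_ hq₁.2.symm)⟩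
  refine Finset.sum_congr rfl fun p _ => Finset.sum_congr rfl fun q _ => ?_
  simp only [infoMat, cexpM, Matrix.add_apply, Matrix.smul_apply, smul_eq_mul,
    Matrix.kroneckerMap_apply, Matrix.of_apply, hentry]
  rw [integral_add ((eL p q).2.1.const_mul _) (eB p q).2.1,
    integral_add ((eL p q).1.const_mul _) (eB p q).1, integral_const_mul, integral_const_mul,
    (eL p q).2.2, (eB p q).2.2]

/-- Persistence of excitation bounds the expected information collected over a window. -/
theorem integral_norm_sq_le_info (S : DelayedAlgorithm μ d H v A lam x0 a b x βv βa βH Ca)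
    {θ : ℝ} {k₀ : ℕ} {s : Finset ℕ} {r : ℕ → ℝ}
    (hpe : ∀ᵐ ω ∂μ, θ ≤ lambdaMin (∑ k ∈ s,
      (r k • (cexpM μ (sigBeforeD H v A lam k₀) (fun ω' => symmLapl (A k ω')) ω
          ⊗ₖ (1 : Matrix (Fin n) (Fin n) ℝ))
        + cexpM μ (sigBeforeD H v A lam k₀) (fun ω' => blockHtH (fun i => H k i ω')) ω))) :
    θ * ∫ ω, ‖errPath x x0 d ω (d + k₀)‖ ^ 2 ∂μ
      ≤ ∑ k ∈ s, ∫ ω, (errPath x x0 d ω (d + k₀)).ofLp ⬝ᵥ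
        infoMat (r k) (A k ω) (fun i => H k i ω) *ᵥ (errPath x x0 d ω (d + k₀)).ofLp ∂μ := by
  have hq := fun k => S.integral_quadForm_infoMat k₀ k (r k)
  rw [← Finset.sum_congr rfl fun k _ => (hq k).2.2, ← integral_finsetSum _ fun k _ => (hq k).2.1,
    ← integral_const_mul]
  refine integral_mono_ae ((S.integrable_norm_errPath_sq k₀).const_mul θ)
    (integrable_finsetSum _ fun k _ => (hq k).2.1) ?_
  filter_upwards [hpe] with ω hω
  have h1 := lambdaMin_mul_sum_sq_le (∑ k ∈ s,
      (r k • (cexpM μ (sigBeforeD H v A lam k₀) (fun ω' => symmLapl (A k ω')) ω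
          ⊗ₖ (1 : Matrix (Fin n) (Fin n) ℝ))
        + cexpM μ (sigBeforeD H v A lam k₀) (fun ω' => blockHtH (fun i => H k i ω')) ω))
    (errPath x x0 d ω (d + k₀)).ofLp
  rw [Matrix.sum_mulVec, dotProduct_sum] at h1
  rw [EuclideanSpace.real_norm_sq_eq]
  exact (mul_le_mul_of_nonneg_right hω (Finset.sum_nonneg fun _ _ => sq_nonneg _)).trans h1

end DelayedAlgorithm

end Excitation

section Window

variable {Ω : Type*} {N n : ℕ} {ni : Fin N → ℕ}

namespace DelayedAlgorithm

variable [m0 : MeasurableSpace Ω] {μ : Measure Ω} [IsProbabilityMeasure μ] {d : ℕ}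
  {H : ℕ → ∀ i : Fin N, Ω → Matrix (Fin (ni i)) (Fin n) ℝ}
  {v : ℕ → Ω → ∀ i : Fin N, Fin (ni i) → ℝ}
  {A : ℕ → Ω → Matrix (Fin N) (Fin N) ℝ}
  {lam : ℕ → Fin N → Fin N → Ω → ℕ} {x0 : Fin n → ℝ} {a b : ℕ → ℝ}
  {x : ℤ → Fin N → Ω → Fin n → ℝ} {βv βa βH Ca : ℝ}

theorem sum_integral_norm_noisePath_sq_le
    (S : DelayedAlgorithm μ d H v A lam x0 a b x βv βa βH Ca) (hβv : 0 ≤ βv) (k₀ j : ℕ) :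
    ∑ i ∈ Finset.range j, ∫ ω, ‖noisePath H v a d ω (d + k₀ + i)‖ ^ 2 ∂μ
      ≤ j * (n * (n * βH ^ 2) * βv) * a k₀ ^ 2 := by
  refine (Finset.sum_le_sum (g := fun _ => n * (n * βH ^ 2) * βv * a k₀ ^ 2) fun i _ => ?_).trans
    (by simp [mul_assoc])
  rw [add_assoc]
  refine (S.integral_norm_noisePath_sq_le (k₀ + i)).trans ?_
  exact mul_le_mul_of_nonneg_left
    (pow_le_pow_left₀ (S.a_pos _).le (S.a_anti (Nat.le_add_right k₀ i)) 2) (by positivity)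

/-- One-window recursion for the expected energy. -/
theorem exists_integral_delayEnergy_window_le
    (S : DelayedAlgorithm μ d H v A lam x0 a b x βv βa βH Ca) (hβv : 0 ≤ βv) {h : ℕ}
    (hh : 1 ≤ h) :
    ∃ K, 0 ≤ K ∧ ∀ (k₀ : ℕ) (θ : ℝ), 2 * θ * a (k₀ + h) ≤ 3 / 8 →
      (∀ᵐ ω ∂μ, θ ≤ lambdaMin (∑ k ∈ Finset.Ico k₀ (k₀ + h),
        ((b k / a k) • (cexpM μ (sigBeforeD H v A lam k₀) (fun ω' => symmLapl (A k ω')) ω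
            ⊗ₖ (1 : Matrix (Fin n) (Fin n) ℝ))
          + cexpM μ (sigBeforeD H v A lam k₀) (fun ω' => blockHtH (fun i => H k i ω')) ω))) →
      ∫ ω, delayEnergy (errPath x x0 d ω) (d + (k₀ + h)) ∂μ
        ≤ (1 - 2 * θ * a (k₀ + h) + K * ((a k₀ - a (k₀ + h)) * (b k₀ / a (k₀ + h)))
            + K * b k₀ ^ 2) * ∫ ω, delayEnergy (errPath x x0 d ω) (d + k₀) ∂μ
          + K * a k₀ ^ 2 := by
  set c := stepConst N n d βa βH Ca with hcdef
  have hc : 0 ≤ c := stepConst_nonneg S.adj_bound_nonneg S.gain_const_nonneg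
  obtain ⟨K₀, hK₀, hwin⟩ := exists_delayEnergy_window_le (EuclideanSpace ℝ (Fin N × Fin n)) h hh
    (c * b 0)
  set Cw : ℝ := n * (n * βH ^ 2) * βv with hCw
  have hCw0 : 0 ≤ Cw := by positivity
  refine ⟨2 * h * c + K₀ * c ^ 2 + K₀ * (h * Cw), by positivity, fun k₀ θ hθ hpe => ?_⟩
  set a' := a (k₀ + h) with ha'
  set δ := (a k₀ - a') * (b k₀ / a') with hδ
  have ha'0 : 0 < a' := S.a_pos _
  have hδ0 : 0 ≤ δ := mul_nonneg (sub_nonneg.2 (S.a_anti (Nat.le_add_right k₀ h)))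
    (div_nonneg (S.b_pos _).le ha'0.le)
  set y := fun ω => errPath x x0 d ω (d + k₀) with hy
  set q : ℕ → Ω → ℝ := fun i ω => (y ω).ofLp ⬝ᵥ
    infoMat (b (k₀ + i) / a (k₀ + i)) (A (k₀ + i) ω) (fun j => H (k₀ + i) j ω) *ᵥ (y ω).ofLp with hq
  have hqi : ∀ i, Integrable (q i) μ := fun i => (S.integral_quadForm_infoMat k₀ (k₀ + i) _).1
  have hwi : ∀ i, Integrable (fun ω => ‖noisePath H v a d ω (d + k₀ + i)‖ ^ 2) μ := fun i => by
    simpa only [add_assoc] using S.integrable_norm_noisePath_sq (k₀ + i)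
  have hii : ∀ i, Integrable (fun ω => inner ℝ (y ω) (noisePath H v a d ω (d + k₀ + i))) μ :=
    fun i => by simpa only [add_assoc] using S.integrable_inner_noisePath k₀ (k₀ + i)
  have hi0 : ∀ i, ∫ ω, inner ℝ (y ω) (noisePath H v a d ω (d + k₀ + i)) ∂μ = 0 :=
    fun i => by
      simpa only [add_assoc] using S.integral_inner_noisePath (Nat.le_add_right k₀ i)
  have hφi := S.integrable_delayEnergy k₀
  have hyi : Integrable (fun ω => ‖y ω‖ ^ 2) μ := S.integrable_norm_errPath_sq k₀
  have hpath : ∀ᵐ ω ∂μ, delayEnergy (errPath x x0 d ω) (d + (k₀ + h))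
      ≤ (1 - 3 / 8 + K₀ * (c * b k₀) ^ 2) * delayEnergy (errPath x x0 d ω) (d + k₀)
        + (3 / 8 + 2 * h * c * δ) * ‖y ω‖ ^ 2
        + (-2 * a') * ∑ i ∈ Finset.range h, q i ω
        + 2 * ∑ i ∈ Finset.range h, inner ℝ (y ω) (noisePath H v a d ω (d + k₀ + i))
        + K₀ * ∑ i ∈ Finset.range h, ‖noisePath H v a d ω (d + k₀ + i)‖ ^ 2 := by
    filter_upwards [S.ae_delayStep, S.adj_bound, S.obs_bound] with ω hstep hA hH
    have h1 := hwin (errPath x x0 d ω) (delayPath A lam b x x0 d ω) (noisePath H v a d ω)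
      (driftPath H A a b d ω) (c * b k₀) (d + k₀) (mul_nonneg hc (S.b_pos _).le)
      (mul_le_mul_of_nonneg_left (S.b_anti (Nat.zero_le k₀)) hc)
      (fun i _ => by simpa only [add_assoc] using hstep k₀ (k₀ + i) (Nat.le_add_right k₀ i))
    have h2 : a' * ∑ i ∈ Finset.range h, q i ω - h * (c * δ * ‖y ω‖ ^ 2)
        ≤ ∑ i ∈ Finset.range h, inner ℝ (y ω) (driftPath H A a b d ω (d + k₀ + i) (y ω)) := by
      have h3 : ∀ i ∈ Finset.range h, a' * q i ω - c * δ * ‖y ω‖ ^ 2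
          ≤ inner ℝ (y ω) (driftPath H A a b d ω (d + k₀ + i) (y ω)) := by
        intro i hi
        have hi := Finset.mem_range.1 hi
        have hsub : d + k₀ + i - d = k₀ + i := by omega
        simp only [driftPath, hsub]
        exact inner_driftMat_ge S.ni_le S.adj_bound_nonneg (hA _) (hH _) S.gain_const_nonneg
          (S.b_pos _).le (S.a_le _) ha'0 (S.a_anti (by omega)) (S.a_anti (by omega))
          (S.b_anti (by omega)) (y ω)
      refine le_trans (le_of_eq ?_) (Finset.sum_le_sum h3)
      rw [Finset.sum_sub_distrib, ← Finset.mul_sum]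
      simp
    have h4 : delayEnergy (errPath x x0 d ω) (d + k₀)
      = ‖y ω‖ ^ 2 + incrementEnergy (errPath x x0 d ω) (d + k₀) := rfl
    rw [← add_assoc d k₀ h]
    linarith
  have hQ : θ * ∫ ω, ‖y ω‖ ^ 2 ∂μ ≤ ∑ i ∈ Finset.range h, ∫ ω, q i ω ∂μ := by
    refine (S.integral_norm_sq_le_info hpe).trans (le_of_eq ?_)
    rw [Finset.sum_Ico_eq_sum_range, Nat.add_sub_cancel_left]
  have hW := S.sum_integral_norm_noisePath_sq_le hβv k₀ h
  have hyφ : ∫ ω, ‖y ω‖ ^ 2 ∂μ ≤ ∫ ω, delayEnergy (errPath x x0 d ω) (d + k₀) ∂μ :=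
    integral_mono hyi hφi fun ω => norm_sq_le_delayEnergy (errPath x x0 d ω) (d + k₀)
  have hy0 : 0 ≤ ∫ ω, ‖y ω‖ ^ 2 ∂μ := integral_nonneg fun ω => sq_nonneg _
  have i₁ := hφi.const_mul (1 - 3 / 8 + K₀ * (c * b k₀) ^ 2)
  have i₂ := hyi.const_mul (3 / 8 + 2 * h * c * δ)
  have i₃ := (integrable_finsetSum (Finset.range h) fun i _ => hqi i).const_mul (-2 * a')
  have i₄ := (integrable_finsetSum (Finset.range h) fun i _ => hii i).const_mul 2
  have i₅ := (integrable_finsetSum (Finset.range h) fun i _ => hwi i).const_mul K₀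
  have hmain := integral_mono_ae (S.integrable_delayEnergy (k₀ + h))
    ((((i₁.add i₂).add i₃).add i₄).add i₅) hpath
  rw [integral_add' (((i₁.add i₂).add i₃).add i₄) i₅, integral_add' ((i₁.add i₂).add i₃) i₄,
    integral_add' (i₁.add i₂) i₃, integral_add' i₁ i₂, integral_const_mul, integral_const_mul,
    integral_const_mul, integral_const_mul, integral_const_mul,
    integral_finsetSum _ fun i _ => hqi i, integral_finsetSum _ fun i _ => hii i,
    integral_finsetSum _ fun i _ => hwi i, Finset.sum_eq_zero fun i _ => hi0 i] at hmain
  set Y := ∫ ω, delayEnergy (errPath x x0 d ω) (d + k₀) ∂μ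
  set Z := ∫ ω, ‖y ω‖ ^ 2 ∂μ
  have hY0 : 0 ≤ Y := hy0.trans hyφ
  have e₁ := mul_le_mul_of_nonneg_left hQ (mul_nonneg zero_le_two ha'0.le)
  have e₂ := mul_le_mul_of_nonneg_left hW hK₀
  have e₃ := mul_le_mul_of_nonneg_left hyφ (sub_nonneg.2 hθ)
  have e₄ := mul_le_mul_of_nonneg_left hyφ (by positivity : 0 ≤ 2 * h * c * δ)
  have p₁ : 0 ≤ (K₀ * c ^ 2 + K₀ * (h * Cw)) * δ * Y := by positivity
  have p₂ : 0 ≤ (2 * h * c + K₀ * (h * Cw)) * b k₀ ^ 2 * Y := by positivity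
  have p₃ : 0 ≤ (2 * h * c + K₀ * c ^ 2) * a k₀ ^ 2 := by positivity
  nlinarith

end DelayedAlgorithm

end Window

section Gains

theorem tendsto_sum_subsequence {a : ℕ → ℝ} (hanti : Antitone a) {h : ℕ} (hh : 1 ≤ h)
    {C : ℝ} (hC : 0 < C) (hshift : ∀ k, a k ≤ C * a (k + h))
    (hdiv : Tendsto (fun K => ∑ k ∈ Finset.range K, a k) atTop atTop) :
    Tendsto (fun M => ∑ m ∈ Finset.range M, a (m * h + h)) atTop atTop := by
  have h1 : ∀ M, ∑ k ∈ Finset.range (M * h), a k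
      ≤ h * C * ∑ m ∈ Finset.range M, a (m * h + h) := by
    intro M
    induction M with
    | zero => simp
    | succ M ih =>
      rw [Nat.succ_mul, Finset.sum_range_add, Finset.sum_range_succ, mul_add]
      refine add_le_add ih ?_
      refine (Finset.sum_le_sum (g := fun _ => C * a (M * h + h)) fun i _ => ?_).trans
        (by simp [mul_assoc])
      exact (hanti (Nat.le_add_right _ _)).trans (hshift _)
  have hhC : (0 : ℝ) < h * C := mul_pos (by exact_mod_cast hh) hC
  have h2 : Tendsto (fun M : ℕ => M * h) atTop atTop := tendsto_id.atTop_mul_const' hh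
  exact (tendsto_const_mul_atTop_of_pos hhC).1 (tendsto_atTop_mono h1 (hdiv.comp h2))

theorem gain_decrease_le {a₀ a' b₀ C D : ℝ} (ha' : 0 < a') (haa : a' ≤ a₀) (haC : a₀ ≤ C * a')
    (hb : 0 ≤ b₀) (hD : 0 ≤ D) (hbD : b₀ ^ 2 ≤ D * a₀) :
    (a₀ - a') * (b₀ / a') ≤ 2 * √D * C * (√a₀ - √a') := by
  have ha₀ : 0 < a₀ := ha'.trans_le haa
  have hs : √a' ≤ √a₀ := Real.sqrt_le_sqrt haa
  have hb₀ : b₀ ≤ √D * √a₀ := by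
    rw [← Real.sqrt_mul hD]
    exact Real.le_sqrt_of_sq_le hbD
  have h1 : a₀ - a' ≤ (√a₀ - √a') * (2 * √a₀) := by
    nlinarith [Real.sq_sqrt ha₀.le, Real.sq_sqrt ha'.le]
  have h2 : √a₀ * (b₀ / a') ≤ √D * C := by
    rw [← mul_div_assoc, div_le_iff₀ ha']
    calc √a₀ * b₀ ≤ √a₀ * (√D * √a₀) := mul_le_mul_of_nonneg_left hb₀ (Real.sqrt_nonneg _)
      _ = √D * a₀ := by rw [mul_left_comm, Real.mul_self_sqrt ha₀.le]
      _ ≤ √D * (C * a') := mul_le_mul_of_nonneg_left haC (Real.sqrt_nonneg _)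
      _ = √D * C * a' := by ring
  calc (a₀ - a') * (b₀ / a') ≤ (√a₀ - √a') * (2 * √a₀) * (b₀ / a') :=
        mul_le_mul_of_nonneg_right h1 (div_nonneg hb ha'.le)
    _ = 2 * (√a₀ - √a') * (√a₀ * (b₀ / a')) := by ring
    _ ≤ 2 * (√a₀ - √a') * (√D * C) :=
        mul_le_mul_of_nonneg_left h2 (mul_nonneg zero_le_two (sub_nonneg.2 hs))
    _ = _ := by ring

theorem tendsto_zero_of_window_recursion {a b Y : ℕ → ℝ} (hapos : ∀ k, 0 < a k)
    (hbpos : ∀ k, 0 < b k) (haanti : Antitone a) (halim : Tendsto a atTop (𝓝 0)) {h : ℕ}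
    (hh : 1 ≤ h) (hshift : a =O[atTop] fun k => a (k + h)) (hbo : (fun k => b k ^ 2) =o[atTop] a)
    (hdiv : Tendsto (fun K => ∑ k ∈ Finset.range K, a k) atTop atTop) {θ K : ℝ} (hθ : 0 < θ)
    (hK : 0 ≤ K) (hY : ∀ m, 0 ≤ Y m)
    (hrec : ∀ m, 2 * θ * a (m * h + h) ≤ 3 / 8 → Y (m + 1)
      ≤ (1 - 2 * θ * a (m * h + h)
          + K * ((a (m * h) - a (m * h + h)) * (b (m * h) / a (m * h + h)))
          + K * b (m * h) ^ 2) * Y m + K * a (m * h) ^ 2) :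
    Tendsto Y atTop (𝓝 0) := by
  obtain ⟨C, hC, hCa⟩ := Asymptotics.bound_of_isBigO_nat_atTop hshift
  have hCa : ∀ k, a k ≤ C * a (k + h) := fun k => by
    have := hCa (x := k) (hapos _).ne'
    rwa [Real.norm_of_nonneg (hapos _).le, Real.norm_of_nonneg (hapos _).le] at this
  obtain ⟨D, hD, hDb⟩ := Asymptotics.bound_of_isBigO_nat_atTop hbo.isBigO
  have hDb : ∀ k, b k ^ 2 ≤ D * a k := fun k => by
    have := hDb (x := k) (hapos _).ne'
    rwa [Real.norm_of_nonneg (sq_nonneg _), Real.norm_of_nonneg (hapos _).le] at this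
  have hmul : Tendsto (fun m : ℕ => m * h) atTop atTop := tendsto_id.atTop_mul_const' hh
  have ha₀ : Tendsto (fun m => a (m * h)) atTop (𝓝 0) := halim.comp hmul
  have ha₁ : Tendsto (fun m => a (m * h + h)) atTop (𝓝 0) :=
    halim.comp (tendsto_atTop_mono (fun m => Nat.le_add_right (m * h) h) hmul)
  refine tendsto_zero_of_perturbed_contraction (α := fun m => θ * a (m * h + h))
    (ε := fun m => K * C / θ * a (m * h)) (s := fun m => K * (2 * √D * C) * √(a (m * h)))
    hY ?_ (fun m => (mul_pos hθ (hapos _)).le) ?_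
    (fun m => mul_nonneg (by positivity) (hapos _).le) ?_
    (fun m => by positivity) ?_ ?_
  · have h1 : Tendsto (fun m => θ * a (m * h + h)) atTop (𝓝 0) := by simpa using ha₁.const_mul θ
    exact h1.eventually_le_const one_pos
  · simp only [← Finset.mul_sum]
    exact (tendsto_sum_subsequence haanti hh hC hCa hdiv).const_mul_atTop hθ
  · simpa using ha₀.const_mul (K * C / θ)
  · intro m m' hm
    exact mul_le_mul_of_nonneg_left (Real.sqrt_le_sqrt (haanti (Nat.mul_le_mul_right h hm)))
      (by positivity)
  · have h1 : ∀ᶠ m in atTop, 2 * θ * a (m * h + h) ≤ 3 / 8 := by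
      have h2 : Tendsto (fun m => 2 * θ * a (m * h + h)) atTop (𝓝 0) := by
        simpa using ha₁.const_mul (2 * θ)
      exact h2.eventually_le_const (by norm_num)
    have h3 : ∀ᶠ m in atTop, b (m * h) ^ 2 ≤ θ / ((K + 1) * C) * a (m * h) := by
      have h4 := hbo.def (c := θ / ((K + 1) * C)) (by positivity)
      filter_upwards [hmul.eventually h4] with m hm
      rwa [Real.norm_of_nonneg (sq_nonneg _), Real.norm_of_nonneg (hapos _).le] at hm
    filter_upwards [h1, h3] with m hm₁ hm₃
    have e₁ : K * b (m * h) ^ 2 ≤ θ * a (m * h + h) := by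
      have e₂ : b (m * h) ^ 2 ≤ θ / (K + 1) * a (m * h + h) := by
        refine hm₃.trans ((mul_le_mul_of_nonneg_left (hCa _) (by positivity)).trans (le_of_eq ?_))
        field_simp
      have e₃ : (K + 1) * b (m * h) ^ 2 ≤ θ * a (m * h + h) := by
        refine (mul_le_mul_of_nonneg_left e₂ (by positivity)).trans (le_of_eq ?_)
        field_simp
      nlinarith [sq_nonneg (b (m * h))]
    have e₄ := mul_le_mul_of_nonneg_left (gain_decrease_le (hapos (m * h + h))
      (haanti (Nat.le_add_right (m * h) h)) (hCa (m * h)) (hbpos (m * h)).le hD.le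
      (hDb (m * h))) hK
    have e₅ : K * a (m * h) ^ 2 ≤ K * C / θ * a (m * h) * (θ * a (m * h + h)) := by
      have e₆ : K * C / θ * a (m * h) * (θ * a (m * h + h))
          = K * (a (m * h) * (C * a (m * h + h))) := by field_simp
      rw [e₆, sq]
      exact mul_le_mul_of_nonneg_left (mul_le_mul_of_nonneg_left (hCa _) (hapos _).le) hK
    refine (hrec m hm₁).trans (add_le_add (mul_le_mul_of_nonneg_right ?_ (hY m)) e₅)
    rw [Nat.succ_mul]
    linarith

end Gains

section Convergence

variable {Ω : Type*} {N n : ℕ} {ni : Fin N → ℕ}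

namespace DelayedAlgorithm

variable [m0 : MeasurableSpace Ω] {μ : Measure Ω} [IsProbabilityMeasure μ] {d : ℕ}
  {H : ℕ → ∀ i : Fin N, Ω → Matrix (Fin (ni i)) (Fin n) ℝ}
  {v : ℕ → Ω → ∀ i : Fin N, Fin (ni i) → ℝ}
  {A : ℕ → Ω → Matrix (Fin N) (Fin N) ℝ}
  {lam : ℕ → Fin N → Fin N → Ω → ℕ} {x0 : Fin n → ℝ} {a b : ℕ → ℝ}
  {x : ℤ → Fin N → Ω → Fin n → ℝ} {βv βa βH Ca : ℝ}

theorem integral_delayEnergy_add_le (S : DelayedAlgorithm μ d H v A lam x0 a b x βv βa βH Ca)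
    (hβv : 0 ≤ βv) (k₀ j : ℕ) :
    ∫ ω, delayEnergy (errPath x x0 d ω) (d + (k₀ + j)) ∂μ
      ≤ (9 + 9 * (stepConst N n d βa βH Ca * b 0) ^ 2) ^ j *
        (∫ ω, delayEnergy (errPath x x0 d ω) (d + k₀) ∂μ
          + j * (n * (n * βH ^ 2) * βv) * a k₀ ^ 2) := by
  have hc := stepConst_nonneg (N := N) (n := n) (d := d) (βH := βH)
    S.adj_bound_nonneg S.gain_const_nonneg
  set L := 9 + 9 * (stepConst N n d βa βH Ca * b 0) ^ 2
  have hwi : ∀ i, Integrable (fun ω => ‖noisePath H v a d ω (d + k₀ + i)‖ ^ 2) μ := fun i => by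
    simpa only [add_assoc] using S.integrable_norm_noisePath_sq (k₀ + i)
  have hws := integrable_finsetSum (Finset.range j) fun i _ => hwi i
  have h1 := integral_mono_ae (S.integrable_delayEnergy (k₀ + j))
    (((S.integrable_delayEnergy k₀).add hws).const_mul (L ^ j)) (by
      filter_upwards [S.ae_delayStep] with ω hω
      have h2 := delayEnergy_add_le (τ := d + k₀) (mul_nonneg hc (S.b_pos 0).le) le_rfl j
        (fun i _ => by simpa only [add_assoc] using hω 0 (k₀ + i) (Nat.zero_le _))
      simpa only [add_assoc, Pi.add_apply] using h2)
  refine h1.trans ?_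
  rw [integral_const_mul, integral_add' (S.integrable_delayEnergy k₀) hws,
    integral_finsetSum _ fun i _ => hwi i]
  exact mul_le_mul_of_nonneg_left
    (add_le_add_right (S.sum_integral_norm_noisePath_sq_le hβv k₀ j) _) (by positivity)

/-- The expected energy vanishes along the whole sequence once it vanishes along windows. -/
theorem tendsto_integral_delayEnergy (S : DelayedAlgorithm μ d H v A lam x0 a b x βv βa βH Ca)
    (hβv : 0 ≤ βv) (halim : Tendsto a atTop (𝓝 0)) {h : ℕ} (hh : 1 ≤ h)
    (hwin : Tendsto (fun m => ∫ ω, delayEnergy (errPath x x0 d ω) (d + m * h) ∂μ) atTop (𝓝 0)) :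
    Tendsto (fun k => ∫ ω, delayEnergy (errPath x x0 d ω) (d + k) ∂μ) atTop (𝓝 0) := by
  have hbd : ∀ k, ∫ ω, delayEnergy (errPath x x0 d ω) (d + k) ∂μ
      ≤ (9 + 9 * (stepConst N n d βa βH Ca * b 0) ^ 2) ^ h *
        (∫ ω, delayEnergy (errPath x x0 d ω) (d + k / h * h) ∂μ
          + h * (n * (n * βH ^ 2) * βv) * a (k / h * h) ^ 2) := by
    intro k
    have hj : k % h ≤ h := (Nat.mod_lt k hh).le
    have h1 := S.integral_delayEnergy_add_le hβv (k / h * h) (k % h)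
    rw [Nat.div_add_mod' k h] at h1
    have hφ : 0 ≤ ∫ ω, delayEnergy (errPath x x0 d ω) (d + k / h * h) ∂μ :=
      integral_nonneg fun ω => delayEnergy_nonneg _ _
    refine h1.trans (mul_le_mul (pow_le_pow_right₀ ?_ hj) (add_le_add_right ?_ _)
      (by positivity) (by positivity))
    · nlinarith [sq_nonneg (stepConst N n d βa βH Ca * b 0)]
    · gcongr
  have hdiv : Tendsto (fun k : ℕ => k / h) atTop atTop := Nat.tendsto_div_const_atTop (by omega)
  have hmul : Tendsto (fun m : ℕ => m * h) atTop atTop := tendsto_id.atTop_mul_const' hh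
  have ha : Tendsto (fun k => a (k / h * h)) atTop (𝓝 0) := halim.comp (hmul.comp hdiv)
  refine squeeze_zero (fun k => integral_nonneg fun ω => delayEnergy_nonneg _ _) hbd ?_
  simpa using ((hwin.comp hdiv).add ((ha.pow 2).const_mul (h * (n * (n * βH ^ 2) * βv)))).const_mul
    ((9 + 9 * (stepConst N n d βa βH Ca * b 0) ^ 2) ^ h)

theorem integral_node_error_le (S : DelayedAlgorithm μ d H v A lam x0 a b x βv βa βH Ca)
    (k : ℕ) (i : Fin N) :
    ∫ ω, ∑ p, (x (k : ℤ) i ω p - x0 p) ^ 2 ∂μ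
      ≤ ∫ ω, delayEnergy (errPath x x0 d ω) (d + k) ∂μ := by
  refine integral_mono_of_nonneg
    (Eventually.of_forall fun ω => Finset.sum_nonneg fun _ _ => sq_nonneg _)
    (S.integrable_delayEnergy k) (Eventually.of_forall fun ω => ?_)
  refine le_trans ?_ (norm_sq_le_delayEnergy _ _)
  have hk : ((d + k : ℕ) : ℤ) - d = k := by push_cast; ring
  rw [EuclideanSpace.real_norm_sq_eq, Fintype.sum_prod_type]
  simp only [errPath, errVec, hk]
  exact Finset.single_le_sum (f := fun i => ∑ p, (x (k : ℤ) i ω p - x0 p) ^ 2)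
    (fun _ _ => Finset.sum_nonneg fun _ _ => sq_nonneg _) (Finset.mem_univ i)

end DelayedAlgorithm

end Convergence

/-- **Corollary 2 (case with random time-varying communication delays, mean square
convergence).**  Under Assumptions (A1.a), (A1.b), (A2.b), (A3.a), (A3.c) and
`inf_{m≥0} (λ_m^h − Δ_m^h) ≥ θ > 0` a.s., the distributed estimation algorithm with
random observation matrices, communication graphs and time-delays converges in mean
square. -/
theorem delayed_mean_square_convergence_intuitive
    {Ω : Type*} [MeasurableSpace Ω] (μ : Measure Ω) [IsProbabilityMeasure μ]
    (N n : ℕ) (hN : 1 ≤ N) (hn : 1 ≤ n) (d : ℕ) (hd : 1 ≤ d)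
    (ni : Fin N → ℕ) (hni : ∀ i, 1 ≤ ni i ∧ ni i ≤ n)
    -- the random observation matrices, noises, adjacency matrices and delays
    (H : ℕ → ∀ i : Fin N, Ω → Matrix (Fin (ni i)) (Fin n) ℝ)
    (v : ℕ → Ω → ∀ i : Fin N, Fin (ni i) → ℝ)
    (A : ℕ → Ω → Matrix (Fin N) (Fin N) ℝ)
    (lam : ℕ → Fin N → Fin N → Ω → ℕ)
    (hHmeas : ∀ k, Measurable (fun ω (i : Fin N) (p : Fin (ni i)) (c : Fin n) => H k i ω p c))
    (hvmeas : ∀ k, Measurable (v k))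
    (hAmeas : ∀ k, Measurable (fun ω (i j : Fin N) => A k ω i j))
    (hlammeas : ∀ k, Measurable (fun ω (j i : Fin N) => lam k j i ω))
    (hAdiag : ∀ k ω i, A k ω i i = 0)
    (hlamrange : ∀ k j i ω, lam k j i ω ≤ d)
    (hlamdiag : ∀ k i, ∀ᵐ ω ∂μ, lam k i i ω = 0)
    (hvL2 : ∀ k, Integrable (fun ω => ∑ i, ∑ p, (v k ω i p)^2) μ)
    -- the unknown parameter and the gain sequences
    (x0 : Fin n → ℝ) (a b : ℕ → ℝ)
    -- the estimates generated by the algorithm with delays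
    (x : ℤ → Fin N → Ω → Fin n → ℝ)
    (hxinit : ∀ s : ℤ, -(d:ℤ) ≤ s → s ≤ 0 → ∀ i, ∃ c : Fin n → ℝ, ∀ ω, x s i ω = c)
    (hrec : ∀ (k : ℕ) (i : Fin N) (ω : Ω), x ((k:ℤ)+1) i ω = fun p =>
      x (k:ℤ) i ω p
        + a k * ((H k i ω)ᵀ.mulVec
            (((H k i ω).mulVec x0 + v k ω i) - (H k i ω).mulVec (x (k:ℤ) i ω))) p
        + b k * ∑ j, A k ω i j * (x ((k:ℤ) - (lam k j i ω : ℤ)) j ω p - x (k:ℤ) i ω p))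
    -- (A1.a): the noise process is independent of observation matrices, graphs and delays
    (hA1a : ProbabilityTheory.IndepFun
      (fun ω => fun k => v k ω)
      (fun ω => fun k =>
        ((fun (i : Fin N) (p : Fin (ni i)) (c : Fin n) => H k i ω p c),
         (fun (i j : Fin N) => A k ω i j),
         (fun (j i : Fin N) => lam k j i ω))) μ)
    -- (A1.b)
    (βv : ℝ) (hβv : 0 < βv)
    (hA1b1 : ∀ k i p, (μ[(fun ω => v k ω i p)|sigBeforeD H v A lam k]) =ᵐ[μ] 0)
    (hA1b2 : ∀ k, ∀ᵐ ω ∂μ,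
      (μ[(fun ω' => ∑ i, ∑ p, (v k ω' i p)^2)|sigBeforeD H v A lam k]) ω ≤ βv)
    -- (A2.b)
    (βa βH : ℝ) (hβa : 0 < βa) (hβH : 0 < βH)
    (hA2b : ∀ᵐ ω ∂μ, (∀ k i j, |A k ω i j| ≤ βa) ∧ (∀ k i, specNorm (H k i ω) ≤ βH))
    -- (A3.a)
    (hapos : ∀ k, 0 < a k) (hbpos : ∀ k, 0 < b k)
    (haanti : Antitone a) (hbanti : Antitone b)
    (halim : Tendsto a atTop (𝓝 0)) (hblim : Tendsto b atTop (𝓝 0))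
    (haOb : a =O[atTop] b)
    (haOshift : ∀ m : ℕ, 1 ≤ m → a =O[atTop] fun k => a (k + m))
    (hbo : (fun k => (b k)^2) =o[atTop] a)
    (hadiv : Tendsto (fun K => ∑ k ∈ Finset.range K, a k) atTop atTop)
    -- (A3.c)
    (Ca : ℝ) (hCa : ∀ k, a k ≤ Ca * b k)
    (hA3c : ∃ B : ℝ, (∀ k, b k ≤ B) ∧ ∃ κ : ℝ, 0 < κ ∧ κ < 1 ∧
      B < min (κ / (2 * (N * βa + N * Real.sqrt N * βa + Ca * βH ^ 2)))
        ((1 - (1 - κ)⁻¹) * κ / (2 * N * Real.sqrt N * βa * (1 - (1 - κ) ^ (-(d + 1 : ℤ))))))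
    -- the matrices F(k) defined by the delay-elimination recursion
    (F : ℤ → Ω → Matrix (Fin N × Fin n) (Fin N × Fin n) ℝ)
    (hFinit : ∀ k : ℤ, -(d:ℤ) ≤ k → k ≤ -1 → ∀ ω, F k ω = 1)
    (hFrec : ∀ (k : ℕ) (ω : Ω), F k ω = 1 -
      (b k • (degMat (A k ω) ⊗ₖ (1 : Matrix (Fin n) (Fin n) ℝ))
        + a k • blockHtH (fun i => H k i ω)
        - b k • ∑ q ∈ Finset.range (d+1),
            delayAdj n (A k ω) (fun j i => lam k j i ω) q *
              (phiProdZ (fun t => F t ω) ((k:ℤ) - 1) ((k:ℤ) - q))⁻¹))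
    -- the condition  inf_{m≥0} (λ_m^h − Δ_m^h) ≥ θ > 0  a.s.
    (h : ℕ) (hh : 1 ≤ h) (θ : ℝ) (hθ : 0 < θ)
    (hpe : ∀ᵐ ω ∂μ, ∀ m : ℕ,
      θ ≤ lambdaMin (∑ k ∈ Finset.Ico (m*h) ((m+1)*h),
            ((b k / a k) •
                (cexpM μ (sigBeforeD H v A lam (m*h)) (fun ω' => symmLapl (A k ω')) ω
                  ⊗ₖ (1 : Matrix (Fin n) (Fin n) ℝ))
              + cexpM μ (sigBeforeD H v A lam (m*h))
                  (fun ω' => blockHtH (fun i => H k i ω')) ω))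
          - ∑ k ∈ Finset.Ico (m*h) ((m+1)*h), (b k / a k) *
              ∑ q ∈ Finset.range (d+1),
                specNorm (cexpM μ (sigBeforeD H v A lam (m*h))
                  (fun ω' => delayAdj n (A k ω') (fun j i => lam k j i ω') q *
                    ((phiProdZ (fun t => F t ω') ((k:ℤ) - 1) ((k:ℤ) - q))⁻¹ - 1)) ω)) :
    -- conclusion: mean square convergence at every node
    ∀ i, Tendsto (fun k : ℕ => ∫ ω, ∑ p, (x (k:ℤ) i ω p - x0 p)^2 ∂μ) atTop (𝓝 0) := by
  have hCa0 : 0 ≤ Ca := by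
    have h1 : 0 < Ca * b 0 := (hapos 0).trans_le (hCa 0)
    exact (pos_of_mul_pos_left h1 (hbpos 0).le).le
  have S : DelayedAlgorithm μ d H v A lam x0 a b x βv βa βH Ca :=
    { ni_le := fun i => (hni i).2
      data_measurable := fun _ => ⟨fun s _ => hHmeas s, fun s _ => hvmeas s, fun s _ => hAmeas s,
        fun s _ => hlammeas s⟩
      delay_le := hlamrange
      noise_sq_integrable := hvL2
      initial := hxinit
      recursion := hrec
      noise_indep := hA1a
      noise_mean := hA1b1
      noise_var := hA1b2
      adj_bound_nonneg := hβa.le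
      adj_bound := hA2b.mono fun ω hω => hω.1
      obs_bound := hA2b.mono fun ω hω k i r c => (abs_apply_le_specNorm _ r c).trans (hω.2 k i)
      a_pos := hapos
      b_pos := hbpos
      a_anti := haanti
      b_anti := hbanti
      gain_const_nonneg := hCa0
      a_le := hCa }
  obtain ⟨K, hK, hwin⟩ := S.exists_integral_delayEnergy_window_le hβv.le hh
  have hY : Tendsto (fun m => ∫ ω, delayEnergy (errPath x x0 d ω) (d + m * h) ∂μ) atTop (𝓝 0) := by
    refine tendsto_zero_of_window_recursion hapos hbpos haanti halim hh (haOshift h hh) hbo hadiv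
      hθ hK (fun m => integral_nonneg fun ω => delayEnergy_nonneg _ _) fun m hm => ?_
    rw [Nat.succ_mul]
    refine hwin (m * h) θ hm ?_
    filter_upwards [hpe] with ω hω
    have h1 := hω m
    rw [Nat.succ_mul] at h1
    refine h1.trans (sub_le_self _ (Finset.sum_nonneg fun k _ => ?_))
    exact mul_nonneg (div_nonneg (hbpos k).le (hapos k).le)
      (Finset.sum_nonneg fun q _ => specNorm_nonneg _)
  intro i
  exact squeeze_zero (fun k => integral_nonneg fun ω => Finset.sum_nonneg fun _ _ => sq_nonneg _)
    (fun k => S.integral_node_error_le k i)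
    (S.tendsto_integral_delayEnergy hβv.le halim hh hY)
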